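/- arXiv:1107.4715 — 5 statements merged into one kernel-verified Lean document; each statement's English description precedes it below -/
import Mathlib

section
/- Let ℓ = 2 or let ℓ > 2 be odd, let n ≥ 1 be an integer, and let q > 0 be the real number with n = 2(q^ℓ + q^{ℓ−1} + ⋯ + q + 1). Then every bipartite graph on n vertices containing no cycle of length 2m for any 2 ≤ m ≤ ℓ has at most (q+1)n/2 edges; that is, z(n, 𝓒_{2ℓ}) ≤ (q+1)n/2. -/
open SimpleGraph

/-- `G` contains a cycle of length `m` (as a subgraph). -/
def HasCycleLength {V : Type*} (G : SimpleGraph V) (m : ℕ) : Prop :=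
  ∃ (v : V) (w : G.Walk v v), w.IsCycle ∧ w.length = m

/-- `G` is `𝓒_{2ℓ}`-free: it contains no cycle of length `2m` for any `2 ≤ m ≤ ℓ`. -/
def EvenCycleFree {V : Type*} (G : SimpleGraph V) (ℓ : ℕ) : Prop :=
  ∀ m, 2 ≤ m → m ≤ ℓ → ¬ HasCycleLength G (2 * m)

/-- Paths between the same ends with small total length coincide. -/
def UniqPaths {V : Type*} (G : SimpleGraph V) (ℓ : ℕ) : Prop :=
  ∀ (a b : V) (p q : G.Walk a b), p.IsPath → q.IsPath →
    p.length + q.length ≤ 2 * ℓ + 1 → p = q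

theorem uniqPaths_of_free {V : Type*} (G : SimpleGraph V) (ℓ : ℕ)
    (hbip : G.Colorable 2) (hfree : EvenCycleFree G ℓ) : UniqPaths G ℓ := by
  classical
  intro a b p q hp hq hlen
  let F : Set (Sym2 V) := {e | e ∈ p.edges ++ q.edges}
  let H : SimpleGraph V := fromEdgeSet F
  have hF : ∀ e ∈ F, e ∈ G.edgeSet := by
    intro e he
    rcases List.mem_append.1 he with h | h
    · exact p.edges_subset_edgeSet h
    · exact q.edges_subset_edgeSet h
  have hHe : H.edgeSet = F := by
    simp only [H, edgeSet_fromEdgeSet]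
    ext e
    constructor
    · exact fun h => h.1
    · exact fun h => ⟨h, fun hd => G.not_isDiag_of_mem_edgeSet (hF e h) hd⟩
  have hle : H ≤ G := by
    rw [← edgeSet_subset_edgeSet, hHe]; exact hF
  have hac : H.IsAcyclic := by
    intro v c hc
    have hlc : c.length ≤ 2 * ℓ + 1 := by
      have hnd : c.edges.Nodup := hc.edges_nodup
      have hsub : c.edges ⊆ p.edges ++ q.edges := by
        intro e he
        have := c.edges_subset_edgeSet he
        rw [hHe] at this
        exact this
      have := (List.Nodup.subperm hnd hsub).length_le
      simp at this
      omega
    have h3 := hc.three_le_length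
    have hc' := hc.mapLe hle
    have hev : Even c.length := by
      have := (two_colorable_iff_forall_loop_even.1 hbip) v (c.mapLe hle)
      simpa using this
    obtain ⟨m, hm⟩ := hev
    refine hfree m (by omega) (by omega) ⟨v, c.mapLe hle, hc', ?_⟩
    rw [Walk.length_map]
    omega
  have hpH : ∀ e ∈ p.edges, e ∈ H.edgeSet := by
    intro e he; rw [hHe]; exact List.mem_append.2 (Or.inl he)
  have hqH : ∀ e ∈ q.edges, e ∈ H.edgeSet := by
    intro e he; rw [hHe]; exact List.mem_append.2 (Or.inr he)
  have := hac.path_unique ⟨p.transfer H hpH, hp.transfer hpH⟩ ⟨q.transfer H hqH, hq.transfer hqH⟩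
  have h2 := congrArg (fun r : H.Path a b => r.1.support) this
  simp only [Walk.support_transfer] at h2
  exact Walk.ext_support h2

theorem UniqPaths.induce {V : Type*} {G : SimpleGraph V} {ℓ : ℕ} (h : UniqPaths G ℓ)
    (s : Set V) : UniqPaths (G.induce s) ℓ := by
  intro a b p q hp hq hlen
  let f : G.induce s →g G := (Embedding.induce s).toHom
  have hf : Function.Injective f := Subtype.val_injective
  apply Walk.map_injective_of_injective hf
  exact h _ _ _ _ (hp.map hf) (hq.map hf) (by simpa using hlen)

open Classical in
/-- Ends of non-backtracking walks with `i` steps after the dart `(u, v)`. -/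
noncomputable def reach {V : Type*} [Fintype V] (G : SimpleGraph V) : ℕ → V → V → Finset V
  | 0, _, v => {v}
  | i + 1, u, v => ((G.neighborFinset v).erase u).biUnion (fun w => reach G i v w)

open Classical in
/-- Number of non-backtracking walks with `i` steps after the dart `(u, v)`. -/
noncomputable def nbw {V : Type*} [Fintype V] (G : SimpleGraph V) : ℕ → V → V → ℝ
  | 0, _, _ => 1
  | i + 1, u, v => ∑ w ∈ (G.neighborFinset v).erase u, nbw G i v w

theorem reach_path {V : Type*} [Fintype V] {G : SimpleGraph V} {ℓ : ℕ} (hU : UniqPaths G ℓ)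
    (i : ℕ) : ∀ (u v x : V), i ≤ ℓ → G.Adj u v → x ∈ reach G i u v →
    ∃ p : G.Walk v x, p.IsPath ∧ p.length = i ∧ u ∉ p.support := by
  classical
  induction i with
  | zero =>
    intro u v x _ huv hx
    simp only [reach, Finset.mem_singleton] at hx
    subst hx
    exact ⟨Walk.nil, by simp, rfl, by simpa using huv.ne⟩
  | succ i ih =>
    intro u v x hi huv hx
    simp only [reach, Finset.mem_biUnion, Finset.mem_erase, mem_neighborFinset] at hx
    obtain ⟨w, ⟨hwu, hvw⟩, hx⟩ := hx
    obtain ⟨p, hp, hpl, hvp⟩ := ih v w x (by omega) hvw hx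
    refine ⟨Walk.cons hvw p, hp.cons hvp, by simp [hpl], ?_⟩
    rw [Walk.support_cons, List.mem_cons, not_or]
    refine ⟨huv.ne, fun hup => ?_⟩
    have hr := hp.takeUntil hup
    have hvr : v ∉ (p.takeUntil u hup).support :=
      fun h => hvp (p.support_takeUntil_subset_support hup h)
    have hl := p.length_takeUntil_le_length hup
    have he := hU v u (Walk.cons hvw (p.takeUntil u hup)) (Walk.cons huv.symm Walk.nil)
      (hr.cons hvr) (by simpa using huv.ne.symm) (by simp; omega)
    have := congrArg (fun w => w.getVert 1) he
    simp at this
    exact hwu this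

theorem reach_disj_child {V : Type*} [Fintype V] {G : SimpleGraph V} {ℓ : ℕ}
    (hU : UniqPaths G ℓ) (i : ℕ) (hi : i + 1 ≤ ℓ) (v w w' : V) (hw : G.Adj v w)
    (hw' : G.Adj v w') (hne : w ≠ w') : Disjoint (reach G i v w) (reach G i v w') := by
  rw [Finset.disjoint_left]
  intro x hx hx'
  obtain ⟨p, hp, hpl, hvp⟩ := reach_path hU i v w x (by omega) hw hx
  obtain ⟨p', hp', hpl', hvp'⟩ := reach_path hU i v w' x (by omega) hw' hx'
  have he := hU v x (Walk.cons hw p) (Walk.cons hw' p') (hp.cons hvp) (hp'.cons hvp')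
    (by simp; omega)
  have := congrArg (fun w => w.getVert 1) he
  simp at this
  exact hne this

theorem reach_disj_level {V : Type*} [Fintype V] {G : SimpleGraph V} {ℓ : ℕ}
    (hU : UniqPaths G ℓ) (i j : ℕ) (hi : i ≤ ℓ) (hj : j ≤ ℓ) (hij : i ≠ j) (u v : V)
    (h : G.Adj u v) : Disjoint (reach G i u v) (reach G j u v) := by
  rw [Finset.disjoint_left]
  intro x hx hx'
  obtain ⟨p, hp, hpl, hvp⟩ := reach_path hU i u v x hi h hx
  obtain ⟨p', hp', hpl', hvp'⟩ := reach_path hU j u v x hj h hx'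
  have he := hU v x p p' hp hp' (by omega)
  exact hij (by rw [← hpl, ← hpl', he])

theorem reach_disj_opp {V : Type*} [Fintype V] {G : SimpleGraph V} {ℓ : ℕ}
    (hU : UniqPaths G ℓ) (i j : ℕ) (hi : i ≤ ℓ) (hj : j ≤ ℓ) (u v : V)
    (h : G.Adj u v) : Disjoint (reach G i u v) (reach G j v u) := by
  rw [Finset.disjoint_left]
  intro x hx hx'
  obtain ⟨p, hp, hpl, hvp⟩ := reach_path hU i u v x hi h hx
  obtain ⟨p', hp', hpl', hvp'⟩ := reach_path hU j v u x hj h.symm hx'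
  have he := hU u x (Walk.cons h p) p' (hp.cons hvp) hp' (by simp; omega)
  apply hvp'
  rw [← he]
  simp

theorem card_reach {V : Type*} [Fintype V] {G : SimpleGraph V} {ℓ : ℕ} (hU : UniqPaths G ℓ)
    (i : ℕ) : ∀ (u v : V), i ≤ ℓ → G.Adj u v → ((reach G i u v).card : ℝ) = nbw G i u v := by
  classical
  induction i with
  | zero => intro u v _ _; simp [reach, nbw]
  | succ i ih =>
    intro u v hi huv
    rw [reach, nbw, Finset.card_biUnion]
    · push_cast
      refine Finset.sum_congr rfl fun w hw => ?_
      simp only [Finset.mem_erase, mem_neighborFinset] at hw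
      exact ih v w (by omega) hw.2
    · intro w hw w' hw' hne
      rw [Finset.mem_coe, Finset.mem_erase, mem_neighborFinset] at hw hw'
      exact reach_disj_child hU i hi v w w' hw.2 hw'.2 hne

theorem sum_nbw_le_card {V : Type*} [Fintype V] {G : SimpleGraph V} {ℓ : ℕ}
    (hU : UniqPaths G ℓ) (u v : V) (h : G.Adj u v) :
    ∑ i ∈ Finset.range (ℓ + 1), (nbw G i u v + nbw G i v u) ≤ Fintype.card V := by
  classical
  let A := (Finset.range (ℓ + 1)).biUnion (fun i => reach G i u v)
  let B := (Finset.range (ℓ + 1)).biUnion (fun i => reach G i v u)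
  have cA : ∀ u v : V, G.Adj u v →
      ((((Finset.range (ℓ + 1)).biUnion (fun i => reach G i u v)).card : ℕ) : ℝ)
        = ∑ i ∈ Finset.range (ℓ + 1), nbw G i u v := by
    intro u v h
    rw [Finset.card_biUnion]
    · push_cast
      refine Finset.sum_congr rfl fun i hi => ?_
      rw [Finset.mem_range] at hi
      exact card_reach hU i u v (by omega) h
    · intro i hi j hj hij
      rw [Finset.mem_coe, Finset.mem_range] at hi hj
      exact reach_disj_level hU i j (by omega) (by omega) hij u v h
  have hd : Disjoint A B := by
    simp only [A, B, Finset.disjoint_biUnion_left, Finset.disjoint_biUnion_right]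
    intro i hi j hj
    rw [Finset.mem_range] at hi hj
    exact reach_disj_opp hU _ _ (by omega) (by omega) u v h
  rw [Finset.sum_add_distrib, ← cA u v h, ← cA v u h.symm]
  have := Finset.card_le_univ (A ∪ B)
  rw [Finset.card_union_of_disjoint hd] at this
  exact_mod_cast this

/-- Jensen for the logarithm. -/
theorem sum_log_le {ι : Type*} (s : Finset ι) (hs : s.Nonempty) (x : ι → ℝ)
    (hx : ∀ i ∈ s, 0 < x i) :
    ∑ i ∈ s, Real.log (x i) ≤ s.card * Real.log ((∑ i ∈ s, x i) / s.card) := by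
  have hk : (0 : ℝ) < s.card := by exact_mod_cast hs.card_pos
  have hS : 0 < ∑ i ∈ s, x i := Finset.sum_pos hx hs
  set m := (∑ i ∈ s, x i) / s.card with hm
  have hmp : 0 < m := div_pos hS hk
  have h1 : ∀ i ∈ s, Real.log (x i) ≤ Real.log m + (x i / m - 1) := by
    intro i hi
    have := Real.log_le_sub_one_of_pos (div_pos (hx i hi) hmp)
    rw [Real.log_div (hx i hi).ne' hmp.ne'] at this
    linarith
  refine (Finset.sum_le_sum h1).trans ?_
  rw [Finset.sum_add_distrib, Finset.sum_sub_distrib, ← Finset.sum_div]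
  have : (∑ i ∈ s, x i) / m = s.card := by
    rw [hm]; field_simp
  rw [this]
  simp

theorem convex_aux : ConvexOn ℝ (Set.Ici (2 : ℝ)) (fun x => x * Real.log (x - 1)) := by
  have hd : ∀ x : ℝ, 1 < x →
      HasDerivAt (fun x : ℝ => x * Real.log (x - 1)) (Real.log (x - 1) + x / (x - 1)) x := by
    intro x hx
    have h1 : HasDerivAt (fun x : ℝ => x - 1) 1 x := (hasDerivAt_id x).sub_const 1
    have := (hasDerivAt_id x).mul (h1.log (by linarith : x - 1 ≠ 0))
    convert! this using 1
    simp
    ring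
  have hd2 : ∀ x : ℝ, 1 < x →
      HasDerivAt (fun x : ℝ => Real.log (x - 1) + x / (x - 1)) ((x - 2) / (x - 1) ^ 2) x := by
    intro x hx
    have hne : x - 1 ≠ 0 := by linarith
    have h1 : HasDerivAt (fun x : ℝ => x - 1) 1 x := (hasDerivAt_id x).sub_const 1
    have := (h1.log hne).add ((hasDerivAt_id x).div h1 hne)
    convert! this using 1
    simp
    field_simp
    ring
  refine MonotoneOn.convexOn_of_deriv (convex_Ici 2) ?_ ?_ ?_
  · intro x hx
    exact (hd x (by have : (2:ℝ) ≤ x := hx; linarith)).continuousAt.continuousWithinAt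
  · intro x hx
    rw [interior_Ici] at hx
    exact (hd x (by have : (2:ℝ) < x := hx; linarith)).differentiableAt.differentiableWithinAt
  · rw [interior_Ici]
    have hm : MonotoneOn (fun x : ℝ => Real.log (x - 1) + x / (x - 1)) (Set.Ioi 2) := by
      refine monotoneOn_of_deriv_nonneg (convex_Ioi 2) ?_ ?_ ?_
      · intro x hx
        exact (hd2 x (by have : (2:ℝ) < x := hx; linarith)).continuousAt.continuousWithinAt
      · intro x hx
        rw [interior_Ioi] at hx
        exact (hd2 x (by have : (2:ℝ) < x := hx; linarith)).differentiableAt.differentiableWithinAt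
      · intro x hx
        rw [interior_Ioi] at hx
        have h2 : (2:ℝ) < x := hx
        rw [(hd2 x (by linarith)).deriv]
        exact div_nonneg (by linarith) (sq_nonneg _)
    intro x hx y hy hxy
    have h2 : (2:ℝ) < x := hx
    have h3 : (2:ℝ) < y := hy
    rw [(hd x (by linarith)).deriv, (hd y (by linarith)).deriv]
    exact hm hx hy hxy

theorem nbw_pos {V : Type*} [Fintype V] {G : SimpleGraph V} [DecidableRel G.Adj]
    (hdeg : ∀ v, 2 ≤ G.degree v) (i : ℕ) : ∀ u v, 0 < nbw G i u v := by
  classical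
  induction i with
  | zero => intro u v; simp [nbw]
  | succ i ih =>
    intro u v
    rw [nbw]
    refine Finset.sum_pos (fun w _ => ih v w) ?_
    rw [← Finset.card_pos]
    have h1 := Finset.pred_card_le_card_erase (s := G.neighborFinset v) (a := u)
    have h2 := hdeg v
    rw [← card_neighborFinset_eq_degree] at h2
    have h3 : (G.neighborFinset v).card - 1 ≤ ((G.neighborFinset v).erase u).card := h1
    convert! (show 0 < ((G.neighborFinset v).erase u).card by omega)

theorem sum_swap {V : Type*} [Fintype V] (G : SimpleGraph V) [DecidableRel G.Adj]
    (g : V → V → ℝ) :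
    ∑ u, ∑ v ∈ G.neighborFinset u, g u v = ∑ v, ∑ u ∈ G.neighborFinset v, g u v := by
  refine Finset.sum_comm' ?_
  intro x y
  simp [G.adj_comm]

theorem log_nbw {V : Type*} [Fintype V] {G : SimpleGraph V} [DecidableRel G.Adj]
    (hdeg : ∀ v, 2 ≤ G.degree v) (i : ℕ) :
    i * ∑ v, (G.degree v : ℝ) * Real.log (G.degree v - 1) ≤
      ∑ u, ∑ v ∈ G.neighborFinset u, Real.log (nbw G i u v) := by
  classical
  induction i with
  | zero => simp [nbw]
  | succ i ih =>
    have key : ∀ v, ∀ u ∈ G.neighborFinset v,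
        Real.log (G.degree v - 1) + (∑ w ∈ (G.neighborFinset v).erase u,
          Real.log (nbw G i v w)) / (G.degree v - 1) ≤ Real.log (nbw G (i + 1) u v) := by
      intro v u hu
      have hd : (2 : ℝ) ≤ G.degree v := by exact_mod_cast hdeg v
      have hc : (((G.neighborFinset v).erase u).card : ℝ) = G.degree v - 1 := by
        rw [Finset.card_erase_of_mem hu, card_neighborFinset_eq_degree,
          Nat.cast_sub (by have := hdeg v; omega)]
        simp
      have hne : ((G.neighborFinset v).erase u).Nonempty := by
        rw [← Finset.card_pos]
        have : (0:ℝ) < (((G.neighborFinset v).erase u).card : ℝ) := by rw [hc]; linarith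
        exact_mod_cast this
      have hJ := sum_log_le _ hne (fun w => nbw G i v w) (fun w _ => nbw_pos hdeg i v w)
      have hn : nbw G (i + 1) u v = ∑ w ∈ (G.neighborFinset v).erase u, nbw G i v w := by
        rw [nbw]
        congr!
      have hp : 0 < nbw G (i + 1) u v := nbw_pos hdeg (i + 1) u v
      rw [← hn, hc, Real.log_div hp.ne' (by linarith)] at hJ
      have : (∑ w ∈ (G.neighborFinset v).erase u,
          Real.log (nbw G i v w)) / (G.degree v - 1) ≤
          Real.log (nbw G (i + 1) u v) - Real.log (G.degree v - 1) := by
        rw [div_le_iff₀ (by linarith)]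
        linarith
      linarith
    rw [sum_swap]
    have h1 : ∑ v, ∑ u ∈ G.neighborFinset v, (Real.log (G.degree v - 1) +
        (∑ w ∈ (G.neighborFinset v).erase u, Real.log (nbw G i v w)) / (G.degree v - 1)) ≤
        ∑ v, ∑ u ∈ G.neighborFinset v, Real.log (nbw G (i + 1) u v) :=
      Finset.sum_le_sum fun v _ => Finset.sum_le_sum fun u hu => key v u hu
    refine le_trans ?_ h1
    have h2 : ∀ v, ∑ u ∈ G.neighborFinset v, (Real.log (G.degree v - 1) +
        (∑ w ∈ (G.neighborFinset v).erase u, Real.log (nbw G i v w)) / (G.degree v - 1)) =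
        (G.degree v : ℝ) * Real.log (G.degree v - 1) +
          ∑ w ∈ G.neighborFinset v, Real.log (nbw G i v w) := by
      intro v
      have hd : (2 : ℝ) ≤ G.degree v := by exact_mod_cast hdeg v
      rw [Finset.sum_add_distrib, Finset.sum_const, card_neighborFinset_eq_degree, nsmul_eq_mul,
        ← Finset.sum_div]
      congr 1
      rw [div_eq_iff (by linarith)]
      have h3 : ∀ u ∈ G.neighborFinset v, ∑ w ∈ (G.neighborFinset v).erase u,
          Real.log (nbw G i v w) = ∑ w ∈ G.neighborFinset v, Real.log (nbw G i v w)
            - Real.log (nbw G i v u) := by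
        intro u hu
        rw [← Finset.add_sum_erase _ _ hu]; ring
      rw [Finset.sum_congr rfl h3, Finset.sum_sub_distrib, Finset.sum_const,
        card_neighborFinset_eq_degree, nsmul_eq_mul]
      ring
    rw [Finset.sum_congr rfl (fun v _ => h2 v), Finset.sum_add_distrib]
    push_cast
    linarith

/-- The total number of non-backtracking walks is large. -/
theorem nbw_total {V : Type*} [Fintype V] [Nonempty V] {G : SimpleGraph V} [DecidableRel G.Adj]
    (hdeg : ∀ v, 2 ≤ G.degree v) (q : ℝ) (hq : 1 ≤ q)
    (hD : (q + 1) * Fintype.card V ≤ ∑ v, (G.degree v : ℝ)) (i : ℕ) :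
    (∑ v, (G.degree v : ℝ)) * q ^ i ≤ ∑ u, ∑ v ∈ G.neighborFinset u, nbw G i u v := by
  classical
  set D := ∑ v, (G.degree v : ℝ) with hDdef
  set N : ℝ := (Fintype.card V : ℝ) with hN
  have hNp : 0 < N := by rw [hN]; exact_mod_cast Fintype.card_pos
  have hDp : 0 < D := by nlinarith
  -- convexity
  have hc := convex_aux.map_sum_le (t := Finset.univ) (w := fun _ : V => 1 / N)
    (p := fun v => (G.degree v : ℝ)) (fun _ _ => by positivity)
    (by simp [hN]) (fun v _ => by
      have := hdeg v
      show (2:ℝ) ≤ _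
      exact_mod_cast this)
  simp only [smul_eq_mul, ← Finset.mul_sum] at hc
  rw [← hDdef] at hc
  have hqd : q ≤ 1 / N * D - 1 := by
    rw [one_div, inv_mul_eq_div, le_sub_iff_add_le, le_div_iff₀ hNp]; exact hD
  have hlq : Real.log q ≤ Real.log (1 / N * D - 1) := Real.log_le_log (by linarith) hqd
  have hA : D * Real.log q ≤ ∑ v, (G.degree v : ℝ) * Real.log (G.degree v - 1) := by
    have h1 : 1 / N * D * Real.log q ≤ 1 / N * D * Real.log (1 / N * D - 1) :=
      mul_le_mul_of_nonneg_left hlq (by positivity)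
    have h2 := h1.trans hc
    rw [mul_assoc] at h2
    exact le_of_mul_le_mul_left h2 (by positivity)
  have hB := log_nbw hdeg i
  -- final Jensen
  let s : Finset (Σ _ : V, V) := Finset.univ.sigma (fun u => G.neighborFinset u)
  have hsc : (s.card : ℝ) = D := by
    simp [s, hDdef, Finset.card_sigma]
  have hsne : s.Nonempty := by
    rw [← Finset.card_pos]
    have : (0 : ℝ) < s.card := by rw [hsc]; exact hDp
    exact_mod_cast this
  have hJ := sum_log_le s hsne (fun x => nbw G i x.1 x.2) (fun x _ => nbw_pos hdeg i _ _)
  have e1 : ∑ x ∈ s, Real.log (nbw G i x.1 x.2) =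
      ∑ u, ∑ v ∈ G.neighborFinset u, Real.log (nbw G i u v) := by
    rw [Finset.sum_sigma]
  have e2 : ∑ x ∈ s, nbw G i x.1 x.2 = ∑ u, ∑ v ∈ G.neighborFinset u, nbw G i u v := by
    rw [Finset.sum_sigma]
  rw [e1, e2, hsc] at hJ
  set T := ∑ u, ∑ v ∈ G.neighborFinset u, nbw G i u v with hT
  have hTp : 0 < T := by
    rw [← e2]; exact Finset.sum_pos (fun x _ => nbw_pos hdeg i _ _) hsne
  have h5 : D * (i * Real.log q) ≤ D * Real.log (T / D) := by
    calc D * (i * Real.log q) = i * (D * Real.log q) := by ring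
      _ ≤ i * ∑ v, (G.degree v : ℝ) * Real.log (G.degree v - 1) :=
        mul_le_mul_of_nonneg_left hA (by positivity)
      _ ≤ _ := hB.trans hJ
  have h6 := le_of_mul_le_mul_left h5 hDp
  rw [← Real.log_pow] at h6
  have h7 := (Real.log_le_log_iff (by positivity) (by positivity)).1 h6
  rw [le_div_iff₀ hDp] at h7
  linarith

theorem moore_min_deg {V : Type*} [Fintype V] [Nonempty V] {G : SimpleGraph V}
    [DecidableRel G.Adj] {ℓ : ℕ} (hU : UniqPaths G ℓ)
    (hdeg : ∀ v, 2 ≤ G.degree v) (q : ℝ) (hq : 1 ≤ q)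
    (hD : (q + 1) * Fintype.card V ≤ ∑ v, (G.degree v : ℝ)) :
    2 * ∑ i ∈ Finset.range (ℓ + 1), q ^ i ≤ Fintype.card V := by
  have hNp : (0 : ℝ) < Fintype.card V := by exact_mod_cast Fintype.card_pos
  have hDp : 0 < ∑ v, (G.degree v : ℝ) := by nlinarith
  have h1 : ∑ u, ∑ v ∈ G.neighborFinset u,
      ∑ i ∈ Finset.range (ℓ + 1), (nbw G i u v + nbw G i v u) ≤
      ∑ u, ∑ v ∈ G.neighborFinset u, (Fintype.card V : ℝ) :=
    Finset.sum_le_sum fun u _ => Finset.sum_le_sum fun v hv =>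
      sum_nbw_le_card hU u v (by simpa using hv)
  have h2 : ∑ u, ∑ v ∈ G.neighborFinset u, (Fintype.card V : ℝ) =
      (∑ v, (G.degree v : ℝ)) * Fintype.card V := by
    simp [Finset.sum_mul]
  have h3 : ∑ u, ∑ v ∈ G.neighborFinset u,
      ∑ i ∈ Finset.range (ℓ + 1), (nbw G i u v + nbw G i v u) =
      ∑ i ∈ Finset.range (ℓ + 1), 2 * ∑ u, ∑ v ∈ G.neighborFinset u, nbw G i u v := by
    have : ∀ i, 2 * ∑ u, ∑ v ∈ G.neighborFinset u, nbw G i u v =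
        ∑ u, ∑ v ∈ G.neighborFinset u, (nbw G i u v + nbw G i v u) := by
      intro i
      simp only [Finset.sum_add_distrib]
      rw [two_mul]
      congr 1
      exact sum_swap G _
    simp only [this]
    rw [Finset.sum_comm]
    refine Finset.sum_congr rfl fun u _ => ?_
    rw [Finset.sum_comm]
  rw [h2, h3] at h1
  have h4 : ∑ i ∈ Finset.range (ℓ + 1), 2 * ((∑ v, (G.degree v : ℝ)) * q ^ i) ≤
      ∑ i ∈ Finset.range (ℓ + 1), 2 * ∑ u, ∑ v ∈ G.neighborFinset u, nbw G i u v :=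
    Finset.sum_le_sum fun i _ => by
      have := nbw_total hdeg q hq hD i
      linarith
  have h5 := h4.trans h1
  simp only [← Finset.mul_sum] at h5
  have h6 : (∑ v, (G.degree v : ℝ)) * (2 * ∑ i ∈ Finset.range (ℓ + 1), q ^ i) ≤
      (∑ v, (G.degree v : ℝ)) * Fintype.card V := by linarith
  exact le_of_mul_le_mul_left h6 hDp

/-- Irregular Moore bound (Alon–Hoory–Linial). -/
theorem moore (ℓ : ℕ) (q : ℝ) (hq : 1 ≤ q) (N : ℕ) : ∀ (V : Type) [Fintype V]
    (G : SimpleGraph V) [DecidableRel G.Adj], Fintype.card V = N → 1 ≤ N → UniqPaths G ℓ →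
    (q + 1) * N ≤ 2 * (G.edgeFinset.card : ℝ) →
    2 * ∑ i ∈ Finset.range (ℓ + 1), q ^ i ≤ N := by
  classical
  induction N with
  | zero => intro V _ G _ _ h; omega
  | succ N ih =>
    intro V _ G _ hcard _ hU he
    have hne : Nonempty V := by
      rw [← Fintype.card_pos_iff]; omega
    have hsum : ∑ v, (G.degree v : ℝ) = 2 * (G.edgeFinset.card : ℝ) := by
      exact_mod_cast G.sum_degrees_eq_twice_card_edges
    by_cases hdeg : ∀ v, 2 ≤ G.degree v
    · have := moore_min_deg hU hdeg q hq (by rw [hsum, hcard]; exact he)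
      rwa [hcard] at this
    · push Not at hdeg
      obtain ⟨x, hx⟩ := hdeg
      have hN : 1 ≤ N := by
        by_contra h0
        have hN0 : N = 0 := by omega
        subst hN0
        have hs : Subsingleton V := by
          rw [← Fintype.card_le_one_iff_subsingleton]; omega
        have : ∀ v, G.degree v = 0 := by
          intro v
          have := G.degree_lt_card_verts v
          omega
        have h2 : ∑ v, (G.degree v : ℝ) = 0 := by simp [this]
        rw [← hsum, h2] at he
        push_cast at he
        linarith
      have hc' : Fintype.card ({x}ᶜ : Set V) = N := by
        rw [Fintype.card_compl_set]
        simp [hcard]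
      have hE := G.card_edgeFinset_induce_compl_singleton x
      rw [card_edgeFinset_deleteIncidenceSet] at hE
      have hE2 : (G.edgeFinset.card : ℝ) - 1 ≤ ((G.induce ({x}ᶜ : Set V)).edgeFinset.card : ℝ) := by
        have : G.edgeFinset.card ≤ (G.induce ({x}ᶜ : Set V)).edgeFinset.card + 1 := by
          rw [hE]; omega
        have : (G.edgeFinset.card : ℝ) ≤ (G.induce ({x}ᶜ : Set V)).edgeFinset.card + 1 := by
          exact_mod_cast this
        linarith
      have := ih ({x}ᶜ : Set V) (G.induce ({x}ᶜ : Set V)) hc' hN (hU.induce _) (by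
        push_cast at he
        linarith)
      push_cast
      linarith

/-- `z(n, 𝓒_{2ℓ}) ≤ (q+1)n/2` where `n = 2(q^ℓ + ⋯ + q + 1)`: every bipartite
`𝓒_{2ℓ}`-free graph on `n` vertices has at most `(q+1)n/2` edges. -/
theorem zarankiewicz_even_cycles_bound (ℓ : ℕ) (hℓ : ℓ = 2 ∨ (2 < ℓ ∧ Odd ℓ))
    (n : ℕ) (hn : 1 ≤ n) (q : ℝ) (hq : 0 < q)
    (hnq : (n : ℝ) = 2 * ∑ i ∈ Finset.range (ℓ + 1), q ^ i)
    (G : SimpleGraph (Fin n)) (hbip : G.Colorable 2) (hfree : EvenCycleFree G ℓ) :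
    (G.edgeSet.ncard : ℝ) ≤ (q + 1) * n / 2 := by
  classical
  have hU := uniqPaths_of_free G ℓ hbip hfree
  have hec : G.edgeSet.ncard = G.edgeFinset.card := by
    rw [← coe_edgeFinset, Set.ncard_coe_finset]
  rw [hec]
  have hn0 : (1 : ℝ) ≤ n := by exact_mod_cast hn
  by_cases hen : n ≤ G.edgeFinset.card
  · by_contra! hlt
    have hen' : (n : ℝ) ≤ G.edgeFinset.card := by exact_mod_cast hen
    set q' : ℝ := 2 * G.edgeFinset.card / n - 1 with hq'
    have hq1 : 1 ≤ q' := by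
      rw [hq', le_sub_iff_add_le, le_div_iff₀ (by linarith)]; linarith
    have hqq : q < q' := by
      rw [hq', lt_sub_iff_add_lt, lt_div_iff₀ (by linarith)]; linarith
    have hM := moore ℓ q' hq1 n (Fin n) G (by simp) hn hU (by
      rw [hq']
      have : (2 * (G.edgeFinset.card : ℝ) / n - 1 + 1) * n = 2 * G.edgeFinset.card := by
        field_simp
        ring
      rw [this])
    have hS : ∑ i ∈ Finset.range (ℓ + 1), q ^ i < ∑ i ∈ Finset.range (ℓ + 1), q' ^ i := by
      refine Finset.sum_lt_sum (fun i _ => pow_le_pow_left₀ hq.le hqq.le i) ⟨1, ?_, by simpa⟩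
      rw [Finset.mem_range]
      omega
    linarith
  · have h1 : (G.edgeFinset.card : ℝ) ≤ n - 1 := by
      have : G.edgeFinset.card + 1 ≤ n := by omega
      have : (G.edgeFinset.card : ℝ) + 1 ≤ n := by exact_mod_cast this
      linarith
    have hg := mul_neg_geom_sum q (ℓ + 1)
    have hp : 0 < q ^ (ℓ + 1) := by positivity
    have : (1 - q) * n ≤ 2 := by
      rw [hnq]; linarith
    linarith
end

section
/- Let ℓ = 2 or let ℓ ≥ 3 be odd, and let a, b ≥ 1 be integers. Then every bipartite graph with parts of sizes a and b containing no cycle of length 2m for any 2 ≤ m ≤ ℓ has at most (ab)^{1/2 + 1/(2ℓ)} + max(a, b) edges; that is, z(a, b, 𝓒_{2ℓ}) ≤ (ab)^{1/2 + 1/(2ℓ)} + max(a, b). -/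
open SimpleGraph

namespace ZUB

/-- Jensen for `log`. -/
lemma sum_log_le {ι : Type*} (s : Finset ι) (g : ι → ℝ) (hs : s.Nonempty)
    (hg : ∀ x ∈ s, 0 < g x) :
    ∑ x ∈ s, Real.log (g x) ≤ s.card * Real.log ((∑ x ∈ s, g x) / s.card) := by
  have hc : (0 : ℝ) < s.card := by exact_mod_cast hs.card_pos
  have hsum : 0 < ∑ x ∈ s, g x := Finset.sum_pos hg hs
  set M := (∑ x ∈ s, g x) / s.card with hM
  have hMpos : 0 < M := by positivity
  have h : ∀ x ∈ s, Real.log (g x) ≤ g x / M - 1 + Real.log M := by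
    intro x hx
    have := Real.log_le_sub_one_of_pos (div_pos (hg x hx) hMpos)
    rw [Real.log_div (hg x hx).ne' hMpos.ne'] at this
    linarith
  calc _ ≤ ∑ x ∈ s, (g x / M - 1 + Real.log M) := Finset.sum_le_sum h
    _ = (∑ x ∈ s, g x) / M - s.card + s.card * Real.log M := by
        rw [Finset.sum_add_distrib, Finset.sum_sub_distrib, ← Finset.sum_div]
        simp
    _ = _ := by
        have : (∑ x ∈ s, g x) / M = s.card := by rw [hM]; field_simp
        rw [this]; ring

/-- Local step of the entropy argument. -/
lemma local_step {ι : Type*} [DecidableEq ι] (s : Finset ι) (g : ι → ℝ) (hs : 2 ≤ s.card)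
    (hg : ∀ x ∈ s, 0 < g x) :
    s.card * Real.log ((s.card : ℝ) - 1) + ∑ x ∈ s, Real.log (g x) ≤
      ∑ u ∈ s, Real.log (∑ x ∈ s.erase u, g x) := by
  have hc : (2 : ℝ) ≤ s.card := by exact_mod_cast hs
  have hd : (0 : ℝ) < (s.card : ℝ) - 1 := by linarith
  have key : ∀ u ∈ s, Real.log ((s.card : ℝ) - 1)
      + (∑ x ∈ s, Real.log (g x) - Real.log (g u)) / ((s.card : ℝ) - 1) ≤
      Real.log (∑ x ∈ s.erase u, g x) := by
    intro u hu
    have hcard : ((s.erase u).card : ℝ) = (s.card : ℝ) - 1 := by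
      rw [Finset.card_erase_of_mem hu, Nat.cast_sub (by omega)]; simp
    have hne : (s.erase u).Nonempty := by
      rw [← Finset.card_pos, Finset.card_erase_of_mem hu]; omega
    have h1 := sum_log_le (s.erase u) g hne (fun x hx => hg x (Finset.mem_of_mem_erase hx))
    have hpos : 0 < ∑ x ∈ s.erase u, g x :=
      Finset.sum_pos (fun x hx => hg x (Finset.mem_of_mem_erase hx)) hne
    rw [hcard, Real.log_div hpos.ne' hd.ne', Finset.sum_erase_eq_sub hu] at h1
    have := (div_le_iff₀' hd).2 h1
    linarith
  refine le_trans (le_of_eq ?_) (Finset.sum_le_sum key)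
  rw [Finset.sum_add_distrib, ← Finset.sum_div, Finset.sum_sub_distrib]
  simp only [Finset.sum_const, nsmul_eq_mul]
  field_simp

lemma convex_xlog : ConvexOn ℝ (Set.Ici 2) (fun x : ℝ => x * Real.log (x - 1)) := by
  have hd : ∀ x ∈ Set.Ici (2:ℝ), HasDerivAt (fun x : ℝ => x * Real.log (x - 1))
      (Real.log (x - 1) + x * (1 / (x - 1))) x := by
    intro x hx
    have hx' : (2:ℝ) ≤ x := hx
    have h1 : HasDerivAt (fun x : ℝ => Real.log (x - 1)) (1 / (x - 1)) x :=
      ((hasDerivAt_id x).sub_const 1).log (by simp; linarith)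
    simpa using (hasDerivAt_id x).fun_mul h1
  refine MonotoneOn.convexOn_of_deriv (convex_Ici 2)
    (fun x hx => (hd x hx).continuousAt.continuousWithinAt)
    (fun x hx => (hd x (interior_subset hx)).differentiableAt.differentiableWithinAt) ?_
  intro x hx y hy hxy
  rw [(hd x (interior_subset hx)).deriv, (hd y (interior_subset hy)).deriv]
  have hx' : (2:ℝ) ≤ x := interior_subset hx
  have hy' : (2:ℝ) ≤ y := interior_subset hy
  have h1 : Real.log ((x-1)/(y-1)) ≤ (x-1)/(y-1) - 1 :=
    Real.log_le_sub_one_of_pos (div_pos (by linarith) (by linarith))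
  rw [Real.log_div (by linarith) (by linarith)] at h1
  have h2 : (x-1)/(y-1) - 1 + x * (1/(x-1)) ≤ y * (1 / (y-1)) := by
    have hx1 : 0 < x - 1 := by linarith
    have hy1 : 0 < y - 1 := by linarith
    have e1 : (x-1)/(y-1) - 1 + x * (1/(x-1)) - y * (1 / (y-1))
      = -((y - x) * (x-2)) / ((x-1)*(y-1)) := by field_simp; ring
    have : -((y - x) * (x-2)) / ((x-1)*(y-1)) ≤ 0 :=
      div_nonpos_of_nonpos_of_nonneg
        (by nlinarith [mul_nonneg (sub_nonneg.2 hxy) (sub_nonneg.2 hx')]) (by positivity)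
    linarith
  linarith

lemma sum_xlog {ι : Type*} (s : Finset ι) (d : ι → ℝ) (hs : s.Nonempty)
    (hd : ∀ x ∈ s, 2 ≤ d x) :
    (∑ x ∈ s, d x) * Real.log ((∑ x ∈ s, d x) / s.card - 1) ≤
      ∑ x ∈ s, d x * Real.log (d x - 1) := by
  have hc : (0 : ℝ) < s.card := by exact_mod_cast hs.card_pos
  have h := convex_xlog.map_sum_le (t := s) (w := fun _ => 1 / (s.card : ℝ)) (p := d)
    (fun _ _ => by positivity) (by simp; field_simp) hd
  simp only [smul_eq_mul, ← Finset.mul_sum] at h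
  have h2 := mul_le_mul_of_nonneg_left h hc.le
  have e : 1 / (s.card : ℝ) * ∑ x ∈ s, d x = (∑ x ∈ s, d x) / s.card := by ring
  rw [e] at h2
  calc _ = (s.card : ℝ) * ((∑ x ∈ s, d x) / s.card * Real.log ((∑ x ∈ s, d x) / s.card - 1)) := by
        field_simp
    _ ≤ _ := h2
    _ = _ := by field_simp

variable {V : Type*} [Fintype V] [DecidableEq V]

/-- Number of nonbacktracking walks with first step `u → v` and `n` further steps. -/
def W (G : SimpleGraph V) [DecidableRel G.Adj] : ℕ → V → V → ℕ
  | 0, _, _ => 1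
  | n + 1, u, v => ∑ x ∈ (G.neighborFinset v).erase u, W G n v x

lemma W_pos (G : SimpleGraph V) [DecidableRel G.Adj]
    (hdeg : ∀ u v, G.Adj u v → 2 ≤ G.degree u) (n : ℕ) :
    ∀ u v, G.Adj u v → 0 < W G n u v := by
  induction n with
  | zero => intro u v _; simp [W]
  | succ n ih =>
    intro u v h
    rw [W]
    refine Finset.sum_pos ?_ ?_
    · intro x hx
      exact ih v x (by simpa using Finset.mem_of_mem_erase hx)
    · rw [← Finset.card_pos, Finset.card_erase_of_mem (by simpa using h.symm)]
      have := hdeg v u h.symm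
      rw [← card_neighborFinset_eq_degree] at this
      omega

lemma dart_comm {G : SimpleGraph V} [DecidableRel G.Adj] {S T : Finset V}
    (hb : G.IsBipartiteWith (S : Set V) T) (f : V → V → ℝ) :
    ∑ u ∈ S, ∑ v ∈ G.neighborFinset u, f u v = ∑ v ∈ T, ∑ u ∈ G.neighborFinset v, f u v := by
  refine Finset.sum_comm' ?_
  intro x y
  simp only [mem_neighborFinset]
  constructor
  · rintro ⟨h1, h2⟩
    exact ⟨h2.symm, by simpa using hb.mem_of_mem_adj (by simpa using h1) h2⟩
  · rintro ⟨h1, h2⟩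
    exact ⟨by simpa using hb.symm.mem_of_mem_adj (by simpa using h2) h1, h1.symm⟩

lemma log_step {G : SimpleGraph V} [DecidableRel G.Adj] {S T : Finset V}
    (hb : G.IsBipartiteWith (S : Set V) T)
    (hdeg : ∀ u v, G.Adj u v → 2 ≤ G.degree u) (hT : ∀ v ∈ T, 2 ≤ G.degree v) (n : ℕ) :
    ∑ v ∈ T, (G.degree v : ℝ) * Real.log ((G.degree v : ℝ) - 1) +
      ∑ u ∈ T, ∑ v ∈ G.neighborFinset u, Real.log (W G n u v) ≤
      ∑ u ∈ S, ∑ v ∈ G.neighborFinset u, Real.log (W G (n+1) u v) := by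
  rw [dart_comm hb, ← Finset.sum_add_distrib]
  refine Finset.sum_le_sum fun v hv => ?_
  have := local_step (G.neighborFinset v) (fun x => (W G n v x : ℝ))
    (by rw [card_neighborFinset_eq_degree]; exact hT v hv)
    (fun x hx => by exact_mod_cast W_pos G hdeg n v x (by simpa using hx))
  simpa [W] using this

lemma log_lower {G : SimpleGraph V} [DecidableRel G.Adj] {S T : Finset V}
    (hb : G.IsBipartiteWith (S : Set V) T)
    (hS : ∀ v ∈ S, 2 ≤ G.degree v) (hT : ∀ v ∈ T, 2 ≤ G.degree v) (k : ℕ) :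
    k * (∑ v ∈ S, (G.degree v : ℝ) * Real.log ((G.degree v : ℝ) - 1) +
      ∑ v ∈ T, (G.degree v : ℝ) * Real.log ((G.degree v : ℝ) - 1)) ≤
      ∑ u ∈ S, ∑ v ∈ G.neighborFinset u, Real.log (W G (2*k) u v) := by
  have hdeg : ∀ u v, G.Adj u v → 2 ≤ G.degree u := by
    intro u v h
    rcases hb.mem_of_adj h with h | h
    · exact hS u (by simpa using h.1)
    · exact hT u (by simpa using h.1)
  induction k with
  | zero => simp [W]
  | succ k ih =>
    have h1 := log_step hb hdeg hT (2*k+1)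
    have h2 := log_step hb.symm hdeg hS (2*k)
    rw [show 2 * (k+1) = 2*k+1+1 by ring]
    push_cast
    linarith

/-- Lower bound for the number of nonbacktracking walks. -/
lemma count_lower {G : SimpleGraph V} [DecidableRel G.Adj] {S T : Finset V}
    (hb : G.IsBipartiteWith (S : Set V) T) (hSne : S.Nonempty) (hTne : T.Nonempty)
    (hS : ∀ v ∈ S, 2 ≤ G.degree v) (hT : ∀ v ∈ T, 2 ≤ G.degree v) (k : ℕ) :
    (G.edgeFinset.card : ℝ) * ((G.edgeFinset.card / S.card - 1) *
      (G.edgeFinset.card / T.card - 1) : ℝ) ^ k ≤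
      ∑ u ∈ S, ∑ v ∈ G.neighborFinset u, (W G (2*k) u v : ℝ) := by
  have hdeg : ∀ u v, G.Adj u v → 2 ≤ G.degree u := by
    intro u v h
    rcases hb.mem_of_adj h with h | h
    · exact hS u (by simpa using h.1)
    · exact hT u (by simpa using h.1)
  have eS : ∑ v ∈ S, (G.degree v : ℝ) = G.edgeFinset.card := by
    exact_mod_cast isBipartiteWith_sum_degrees_eq_card_edges hb
  have eT : ∑ v ∈ T, (G.degree v : ℝ) = G.edgeFinset.card := by
    exact_mod_cast isBipartiteWith_sum_degrees_eq_card_edges' hb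
  have h1 := log_lower hb hS hT k
  have h2 := sum_xlog S (fun v => (G.degree v : ℝ)) hSne (fun v hv => by exact_mod_cast hS v hv)
  have h3 := sum_xlog T (fun v => (G.degree v : ℝ)) hTne (fun v hv => by exact_mod_cast hT v hv)
  rw [eS] at h2
  rw [eT] at h3
  have cS : (0:ℝ) < S.card := by exact_mod_cast hSne.card_pos
  have cT : (0:ℝ) < T.card := by exact_mod_cast hTne.card_pos
  have bS : 2 * (S.card : ℝ) ≤ G.edgeFinset.card := by
    rw [← eS, mul_comm, ← nsmul_eq_mul]
    exact Finset.card_nsmul_le_sum _ _ _ (fun v hv => by exact_mod_cast hS v hv)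
  have bT : 2 * (T.card : ℝ) ≤ G.edgeFinset.card := by
    rw [← eT, mul_comm, ← nsmul_eq_mul]
    exact Finset.card_nsmul_le_sum _ _ _ (fun v hv => by exact_mod_cast hT v hv)
  set e : ℝ := (G.edgeFinset.card : ℝ) with he
  have epos : 0 < e := by linarith
  have pS : 0 < e / S.card - 1 := by
    have := (le_div_iff₀ cS).2 bS; linarith
  have pT : 0 < e / T.card - 1 := by
    have := (le_div_iff₀ cT).2 bT; linarith
  have hcard : ((S.sigma fun u => G.neighborFinset u).card : ℝ) = e := by
    rw [Finset.card_sigma, ← eS]; simp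
  have hne : (S.sigma fun u => G.neighborFinset u).Nonempty := by
    rw [← Finset.card_pos]
    have : (0:ℝ) < ((S.sigma fun u => G.neighborFinset u).card : ℝ) := by rw [hcard]; exact epos
    exact_mod_cast this
  have hpos : ∀ x ∈ S.sigma fun u => G.neighborFinset u, (0:ℝ) < W G (2*k) x.1 x.2 := by
    intro x hx
    rw [Finset.mem_sigma] at hx
    exact_mod_cast W_pos G hdeg (2*k) x.1 x.2 (by simpa using hx.2)
  have h4 := sum_log_le (S.sigma fun u => G.neighborFinset u)
    (fun x => (W G (2*k) x.1 x.2 : ℝ)) hne hpos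
  have hNpos := Finset.sum_pos hpos hne
  rw [hcard] at h4
  rw [Finset.sum_sigma] at h4 hNpos
  rw [Finset.sum_sigma] at h4
  dsimp only at h4 hNpos
  set N : ℝ := ∑ u ∈ S, ∑ v ∈ G.neighborFinset u, (W G (2*k) u v : ℝ) with hN
  have h5 : e * (k * (Real.log (e / S.card - 1) + Real.log (e / T.card - 1))) ≤
      e * Real.log (N / e) := by
    refine le_trans ?_ (h1.trans h4)
    have : (0:ℝ) ≤ k := by positivity
    nlinarith [mul_le_mul_of_nonneg_left (add_le_add h2 h3) this]
  have h6 := le_of_mul_le_mul_left h5 epos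
  rw [← Real.log_mul pS.ne' pT.ne', ← Real.log_pow,
    Real.log_le_log_iff (pow_pos (mul_pos pS pT) k) (div_pos hNpos epos), le_div_iff₀ epos] at h6
  rw [mul_comm]
  exact h6

lemma nb_unique {G : SimpleGraph V} {ℓ : ℕ} (c : G.Coloring Bool) (hf : EvenCycleFree G ℓ)
    {u w : V} (p q : G.Walk u w) (hp : p.edges.IsChain (· ≠ ·)) (hq : q.edges.IsChain (· ≠ ·))
    (lp : p.length ≤ ℓ) (lq : q.length ≤ ℓ) : p = q := by
  set H : SimpleGraph V := fromEdgeSet {e | e ∈ p.edges ∨ e ∈ q.edges} with hH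
  have hHedge : H.edgeSet ⊆ {e | e ∈ p.edges ∨ e ∈ q.edges} := by
    rw [hH, edgeSet_fromEdgeSet]; exact Set.sdiff_subset
  have hG : H.edgeSet ⊆ G.edgeSet := by
    intro e he
    rcases hHedge he with h | h
    · exact p.edges_subset_edgeSet h
    · exact q.edges_subset_edgeSet h
  have hpH : ∀ e ∈ p.edges, e ∈ H.edgeSet := by
    intro e he
    rw [hH, edgeSet_fromEdgeSet]
    exact ⟨Or.inl he, fun h => G.not_isDiag_of_mem_edgeSet (p.edges_subset_edgeSet he) (by simpa using h)⟩
  have hqH : ∀ e ∈ q.edges, e ∈ H.edgeSet := by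
    intro e he
    rw [hH, edgeSet_fromEdgeSet]
    exact ⟨Or.inr he, fun h => G.not_isDiag_of_mem_edgeSet (q.edges_subset_edgeSet he) (by simpa using h)⟩
  by_cases hac : H.IsAcyclic
  · have p1 : (p.transfer H hpH).IsPath := by
      rw [hac.isPath_iff_isChain, Walk.edges_transfer]; exact hp
    have q1 : (q.transfer H hqH).IsPath := by
      rw [hac.isPath_iff_isChain, Walk.edges_transfer]; exact hq
    have := (hac.subsingleton_path u w).elim ⟨_, p1⟩ ⟨_, q1⟩
    have h2 : p.transfer H hpH = q.transfer H hqH := congrArg Subtype.val this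
    have h3 : p.support = q.support := by
      rw [← Walk.support_transfer p hpH, ← Walk.support_transfer q hqH, h2]
    exact Walk.ext_support h3
  · exfalso
    rw [IsAcyclic] at hac
    push Not at hac
    obtain ⟨v, cy, hcy⟩ := hac
    have hcG : ∀ e ∈ cy.edges, e ∈ G.edgeSet := fun e he => hG (cy.edges_subset_edgeSet he)
    have hcy' := hcy.transfer hcG
    have hlen : cy.length ≤ 2 * ℓ := by
      have h1 : cy.edges.toFinset ⊆ p.edges.toFinset ∪ q.edges.toFinset := by
        intro e he
        simpa using hHedge (cy.edges_subset_edgeSet (by simpa using he))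
      have h2 := Finset.card_le_card h1
      rw [List.toFinset_card_of_nodup hcy.edges_nodup, Walk.length_edges] at h2
      have h3 := Finset.card_union_le p.edges.toFinset q.edges.toFinset
      have h4 := p.edges.toFinset_card_le
      have h5 := q.edges.toFinset_card_le
      rw [Walk.length_edges] at h4 h5
      omega
    have heven : Even (cy.transfer G hcG).length := (c.even_length_iff_congr _).2 Iff.rfl
    obtain ⟨m, hm⟩ := heven
    have h3 := hcy'.three_le_length
    rw [Walk.length_transfer] at hm h3
    exact hf m (by omega) (by omega) ⟨v, _, hcy', by rw [Walk.length_transfer]; omega⟩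

lemma exists_walks (G : SimpleGraph V) [DecidableRel G.Adj] (n : ℕ) :
    ∀ u v, G.Adj u v → ∃ F : Finset (Σ w, G.Walk u w), F.card = W G n u v ∧
      ∀ p ∈ F, p.2.edges.IsChain (· ≠ ·) ∧ p.2.length = n + 1 ∧ p.2.snd = v := by
  classical
  induction n with
  | zero =>
    intro u v h
    refine ⟨{⟨v, Walk.cons h Walk.nil⟩}, by simp [W], ?_⟩
    intro p hp
    rw [Finset.mem_singleton] at hp
    subst hp
    simp
  | succ n ih =>
    intro u v h
    choose! F hF1 hF2 using ih
    let ι : (Σ w, G.Walk v w) → (Σ w, G.Walk u w) := fun p => ⟨p.1, Walk.cons h p.2⟩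
    have hι : Function.Injective ι := by
      rintro ⟨w, p⟩ ⟨w', p'⟩ hpp
      simp only [ι, Sigma.mk.injEq] at hpp
      obtain ⟨rfl, h2⟩ := hpp
      simpa using h2
    refine ⟨(((G.neighborFinset v).erase u).biUnion (F v)).image ι, ?_, ?_⟩
    · rw [Finset.card_image_of_injective _ hι, Finset.card_biUnion, W]
      · refine Finset.sum_congr rfl fun x hx => hF1 v x (by simpa using Finset.mem_of_mem_erase hx)
      · intro x hx y hy hxy
        rw [Function.onFun, Finset.disjoint_left]
        intro p hp hp'
        exact hxy ((hF2 v x (by simpa using Finset.mem_of_mem_erase hx) p hp).2.2.symm.trans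
          (hF2 v y (by simpa using Finset.mem_of_mem_erase hy) p hp').2.2)
    · intro q hq
      rw [Finset.mem_image] at hq
      obtain ⟨⟨w, p⟩, hp, rfl⟩ := hq
      rw [Finset.mem_biUnion] at hp
      obtain ⟨x, hx, hp⟩ := hp
      obtain ⟨h1, h2, h3⟩ := hF2 v x (by simpa using Finset.mem_of_mem_erase hx) _ hp
      have hxu : x ≠ u := (Finset.mem_erase.1 hx).1
      dsimp only at h1 h2 h3
      refine ⟨?_, by simp [ι, h2], by simp [ι]⟩
      cases p with
      | nil => simp at h2
      | cons h' p' =>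
        simp only [Walk.snd_cons] at h3
        subst h3
        simp only [ι, Walk.edges_cons] at h1 ⊢
        rw [List.isChain_cons_cons]
        refine ⟨?_, h1⟩
        intro he
        rw [Sym2.eq_iff] at he
        rcases he with he | he
        · exact h.ne he.1
        · exact hxu he.1.symm

/-- Upper bound for the number of nonbacktracking walks. -/
lemma count_upper {G : SimpleGraph V} [DecidableRel G.Adj] {ℓ : ℕ} (c : G.Coloring Bool)
    (hf : EvenCycleFree G ℓ) (n : ℕ) (hn : n + 1 ≤ ℓ) (S X : Finset V)
    (hX : ∀ u ∈ S, ∀ w, ∀ p : G.Walk u w, p.length = n + 1 → w ∈ X) :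
    ∑ u ∈ S, ∑ v ∈ G.neighborFinset u, W G n u v ≤ S.card * X.card := by
  classical
  rw [← smul_eq_mul]
  refine Finset.sum_le_card_nsmul _ _ _ fun u hu => ?_
  choose! F hF1 hF2 using exists_walks G n
  have h1 : ((G.neighborFinset u).biUnion (F u)).card = ∑ v ∈ G.neighborFinset u, W G n u v := by
    rw [Finset.card_biUnion]
    · exact Finset.sum_congr rfl fun x hx => hF1 u x (by simpa using hx)
    · intro x hx y hy hxy
      rw [Function.onFun, Finset.disjoint_left]
      intro p hp hp'
      exact hxy ((hF2 u x (by simpa using hx) p hp).2.2.symm.trans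
          (hF2 u y (by simpa using hy) p hp').2.2)
  rw [← h1]
  refine Finset.card_le_card_of_injOn Sigma.fst ?_ ?_
  · intro p hp
    simp only [Finset.coe_biUnion, Set.mem_iUnion, Finset.mem_coe] at hp
    obtain ⟨x, hx, hp⟩ := hp
    exact hX u hu p.1 p.2 (hF2 u x (by simpa using hx) p hp).2.1
  · rintro ⟨w, p⟩ hp ⟨w', q⟩ hq hpq
    dsimp only at hpq
    subst hpq
    simp only [Finset.coe_biUnion, Set.mem_iUnion, Finset.mem_coe] at hp hq
    obtain ⟨x, hx, hp⟩ := hp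
    obtain ⟨y, hy, hq⟩ := hq
    obtain ⟨a1, a2, -⟩ := hF2 u x (by simpa using hx) _ hp
    obtain ⟨b1, b2, -⟩ := hF2 u y (by simpa using hy) _ hq
    dsimp only at a1 a2 b1 b2
    rw [nb_unique c hf p q a1 b1 (by omega) (by omega)]

/-- The colouring of a bipartite graph. -/
def bcol {G : SimpleGraph V} {S T : Finset V}
    (hb : G.IsBipartiteWith (S : Set V) T) : G.Coloring Bool :=
  Coloring.mk (fun v => decide (v ∈ S)) (by
    intro u v h
    have hd := Finset.disjoint_coe.1 hb.disjoint
    rw [Finset.disjoint_left] at hd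
    rcases hb.mem_of_adj h with ⟨h1, h2⟩ | ⟨h1, h2⟩
    · have h1' : u ∈ S := by simpa using h1
      have h2' : v ∉ S := fun h => hd h (by simpa using h2)
      simp [h1', h2']
    · have h1' : u ∉ S := fun h => hd h (by simpa using h1)
      have h2' : v ∈ S := by simpa using h2
      simp [h1', h2'])

lemma walk_end {G : SimpleGraph V} {S T : Finset V}
    (hb : G.IsBipartiteWith (S : Set V) T) {u w : V} (p : G.Walk u w) :
    (u ∈ S → Odd p.length → w ∈ T) ∧ (u ∈ T → Odd p.length → w ∈ S) ∧
    (u ∈ S → Even p.length → w ∈ S) ∧ (u ∈ T → Even p.length → w ∈ T) := by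
  induction p with
  | nil => simp
  | cons h p ih =>
    simp only [Walk.length_cons, Nat.even_add_one, Nat.odd_add_one, Nat.not_even_iff_odd,
      Nat.not_odd_iff_even]
    have h1 := fun hu => hb.mem_of_mem_adj hu h
    have h2 := fun hu => hb.symm.mem_of_mem_adj hu h
    simp only [Finset.mem_coe] at h1 h2
    tauto

lemma core {G : SimpleGraph V} [DecidableRel G.Adj] {S T : Finset V} {k : ℕ}
    (hb : G.IsBipartiteWith (S : Set V) T) (hSne : S.Nonempty) (hTne : T.Nonempty)
    (hS : ∀ v ∈ S, 2 ≤ G.degree v) (hT : ∀ v ∈ T, 2 ≤ G.degree v)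
    (hf : EvenCycleFree G (2 * k + 1)) :
    (G.edgeFinset.card : ℝ) * ((G.edgeFinset.card / S.card - 1) *
      (G.edgeFinset.card / T.card - 1) : ℝ) ^ k ≤ S.card * T.card := by
  refine (count_lower hb hSne hTne hS hT k).trans ?_
  have := count_upper (bcol hb) hf (2*k) le_rfl S T
    (fun u hu w p hp => (walk_end hb p).1 hu (by rw [hp]; exact odd_two_mul_add_one k))
  exact_mod_cast this

lemma core_arith (k : ℕ) (e s t : ℝ) (hs : 0 < s) (ht : 0 < t) (he : s + t < e)
    (h : e * ((e / s - 1) * (e / t - 1)) ^ k ≤ s * t) :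
    ((1 + (e - s - t) / s) * (1 + (e - s - t) / t)) ^ (2 * k + 1) ≤ s * t := by
  have hQ : (1 + (e - s - t) / s) * (1 + (e - s - t) / t) = (e / s - 1) * (e / t - 1) := by
    field_simp; ring
  have h0 : 0 < (1 + (e - s - t) / s) * (1 + (e - s - t) / t) := by
    have : 0 < e - s - t := by linarith
    positivity
  rw [hQ] at h0 ⊢
  have h1 : (e / s - 1) * (e / t - 1) * (s * t) ≤ e ^ 2 := by
    have : (e / s - 1) * (e / t - 1) * (s * t) = (e - s) * (e - t) := by field_simp
    rw [this]; nlinarith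
  set Q := (e / s - 1) * (e / t - 1)
  have hst : 0 < s * t := by positivity
  have he0 : 0 < e := by linarith
  have h2 : (e * Q ^ k) ^ 2 ≤ (s * t) ^ 2 := by gcongr
  have h3 : Q ^ (2*k+1) * (s * t) ≤ (s * t) * (s * t) := by
    calc Q ^ (2*k+1) * (s * t) = (Q ^ k)^2 * (Q * (s*t)) := by ring
      _ ≤ (Q ^ k)^2 * e^2 := by gcongr
      _ = (e * Q ^ k) ^ 2 := by ring
      _ ≤ _ := h2
      _ = _ := by ring
  exact le_of_mul_le_mul_right h3 hst

/-- The inductive statement. -/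
def P (k : ℕ) (e s t : ℕ) : Prop :=
  ((1 + ((e : ℝ) - s - t) / s) * (1 + ((e : ℝ) - s - t) / t)) ^ (2 * k + 1) ≤ (s : ℝ) * t

lemma P_symm {k e s t : ℕ} (h : P k e s t) : P k e t s := by
  unfold P at *
  have e1 : (e : ℝ) - t - s = e - s - t := by ring
  rw [e1, mul_comm, mul_comm (t : ℝ)]
  exact h

lemma P_mono {k e s t e' s' : ℕ} (hs : 0 < s') (ht : 0 < t) (hss : s' ≤ s) (he : s + t ≤ e)
    (hee : e + s' ≤ e' + s) (h : P k e' s' t) : P k e s t := by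
  unfold P at *
  have hs1 : (0:ℝ) < s' := by exact_mod_cast hs
  have ht1 : (0:ℝ) < t := by exact_mod_cast ht
  have hss1 : (s':ℝ) ≤ s := by exact_mod_cast hss
  have he1 : (s:ℝ) + t ≤ e := by exact_mod_cast he
  have hee1 : (e:ℝ) + s' ≤ e' + s := by exact_mod_cast hee
  have hc : (0:ℝ) ≤ (e:ℝ) - s - t := by linarith
  have hcc : (e:ℝ) - s - t ≤ (e':ℝ) - s' - t := by linarith
  have hs2 : (0:ℝ) < s := by linarith
  calc _ ≤ ((1 + ((e' : ℝ) - s' - t) / s') * (1 + ((e' : ℝ) - s' - t) / t)) ^ (2 * k + 1) := by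
        have : (0:ℝ) ≤ (e':ℝ) - s' - t := by linarith
        gcongr
    _ ≤ _ := h
    _ ≤ _ := by gcongr

lemma EvenCycleFree_mono {G H : SimpleGraph V} (hle : H ≤ G) {ℓ : ℕ} (h : EvenCycleFree G ℓ) :
    EvenCycleFree H ℓ := by
  intro m h2 hm ⟨v, w, hw, hl⟩
  exact h m h2 hm ⟨v, w.mapLe hle, hw.mapLe hle, by simpa using hl⟩

lemma card_pos_left {G : SimpleGraph V} [DecidableRel G.Adj] {S T : Finset V}
    (hb : G.IsBipartiteWith (S : Set V) T) (he : S.card + T.card < G.edgeFinset.card) :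
    0 < S.card := by
  rw [Finset.card_pos]
  by_contra h
  rw [Finset.not_nonempty_iff_eq_empty] at h
  subst h
  have := isBipartiteWith_sum_degrees_eq_card_edges hb
  simp only [Finset.sum_empty] at this
  omega

lemma step {k : ℕ} {G : SimpleGraph V} [DecidableRel G.Adj] {S T : Finset V}
    (ih : ∀ (H : SimpleGraph V) [DecidableRel H.Adj] (S' T' : Finset V),
      S'.card + T'.card < S.card + T.card → H.IsBipartiteWith (S' : Set V) T' →
      EvenCycleFree H (2*k+1) → S'.card + T'.card < H.edgeFinset.card →
      P k H.edgeFinset.card S'.card T'.card)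
    (hb : G.IsBipartiteWith (S : Set V) T) (hf : EvenCycleFree G (2*k+1))
    (he : S.card + T.card < G.edgeFinset.card) (v : V) (hv : v ∈ S) (hd : G.degree v < 2) :
    P k G.edgeFinset.card S.card T.card := by
  have hSc := Finset.card_erase_of_mem hv
  have hSp : 0 < S.card := Finset.card_pos.2 ⟨v, hv⟩
  have hb' : (G.deleteIncidenceSet v).IsBipartiteWith ((S.erase v : Finset V) : Set V) T := by
    refine ⟨hb.disjoint.mono_left (by simp), ?_⟩
    intro x y hxy
    rw [deleteIncidenceSet_adj] at hxy
    have := hb.mem_of_adj hxy.1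
    simp only [Finset.mem_coe, Finset.mem_erase] at this ⊢
    tauto
  have hcard := G.card_edgeFinset_deleteIncidenceSet v
  have he' : (S.erase v).card + T.card < (G.deleteIncidenceSet v).edgeFinset.card := by omega
  have h1 := ih (G.deleteIncidenceSet v) (S.erase v) T (by omega) hb'
    (EvenCycleFree_mono (G.deleteIncidenceSet_le v) hf) he'
  have h2 := card_pos_left hb' he'
  have h3 := card_pos_left hb'.symm (by omega)
  exact P_mono h2 h3 (by omega) (by omega) (by omega) h1

lemma main_odd (k n : ℕ) : ∀ (G : SimpleGraph V) [DecidableRel G.Adj] (S T : Finset V),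
    S.card + T.card = n → G.IsBipartiteWith (S : Set V) T →
      EvenCycleFree G (2*k+1) → S.card + T.card < G.edgeFinset.card →
      P k G.edgeFinset.card S.card T.card := by
  induction n using Nat.strong_induction_on with
  | _ n ih =>
    intro G _ S T hn hb hf he
    subst hn
    by_cases hS : ∃ v ∈ S, G.degree v < 2
    · obtain ⟨v, hv, hd⟩ := hS
      exact step (fun H _ S' T' hlt => ih _ hlt H S' T' rfl) hb hf he v hv hd
    by_cases hT : ∃ v ∈ T, G.degree v < 2
    · obtain ⟨v, hv, hd⟩ := hT
      refine P_symm (step (fun H _ S' T' hlt => ih _ (by omega) H S' T' rfl) hb.symm hf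
        (by omega) v hv hd)
    push Not at hS hT
    have pS := card_pos_left hb he
    have pT := card_pos_left hb.symm (by omega)
    exact core_arith k _ _ _ (by exact_mod_cast pS) (by exact_mod_cast pT) (by exact_mod_cast he)
      (core hb (Finset.card_pos.1 pS) (Finset.card_pos.1 pT) hS hT hf)

lemma c4_bound {G : SimpleGraph V} [DecidableRel G.Adj] {S T : Finset V}
    (hb : G.IsBipartiteWith (S : Set V) T) (hf : EvenCycleFree G 2) :
    (G.edgeFinset.card : ℝ) * (G.edgeFinset.card - S.card) ≤ S.card * (T.card : ℝ) ^ 2 := by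
  have h1 := count_upper (bcol hb) hf 1 le_rfl T T
    (fun u hu w p hp => (walk_end hb p).2.2.2 hu (by rw [hp]; decide))
  have eS : ∑ v ∈ S, (G.degree v : ℝ) = G.edgeFinset.card := by
    exact_mod_cast isBipartiteWith_sum_degrees_eq_card_edges hb
  have h2 : ∑ u ∈ T, ∑ v ∈ G.neighborFinset u, (W G 1 u v : ℝ) ≤ T.card * T.card := by
    exact_mod_cast h1
  rw [dart_comm hb.symm] at h2
  have h3 : ∀ v ∈ S, ∑ u ∈ G.neighborFinset v, (W G 1 u v : ℝ) =
      (G.degree v : ℝ) ^ 2 - G.degree v := by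
    intro v _
    have : ∀ u ∈ G.neighborFinset v, (W G 1 u v : ℝ) = (G.degree v : ℝ) - 1 := by
      intro u hu
      have hpos : 0 < (G.neighborFinset v).card := Finset.card_pos.2 ⟨u, hu⟩
      simp only [W, Finset.sum_const, smul_eq_mul, mul_one]
      rw [Finset.card_erase_of_mem hu, Nat.cast_sub hpos]
      simp
    rw [Finset.sum_congr rfl this]
    simp
    ring
  rw [Finset.sum_congr rfl h3, Finset.sum_sub_distrib, eS] at h2
  have h4 := sq_sum_le_card_mul_sum_sq (s := S) (f := fun v => (G.degree v : ℝ))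
  rw [eS] at h4
  have : (0:ℝ) ≤ S.card := by positivity
  nlinarith [mul_le_mul_of_nonneg_left h2 this]

lemma final_two (e a b : ℝ) (ha : 1 ≤ a) (hb : 1 ≤ b) (hba : b ≤ a)
    (h : e * (e - a) ≤ a * b ^ 2) :
    e ≤ (a * b) ^ ((3:ℝ)/4) + a := by
  by_cases hea : e ≤ a
  · have : 0 ≤ (a * b) ^ ((3:ℝ)/4) := by positivity
    linarith
  push Not at hea
  have h0 : 0 < a * b := by positivity
  have h1 : (e - a)^2 ≤ a * b^2 := by nlinarith
  have h2 : (e - a)^4 ≤ ((a * b) ^ ((3:ℝ)/4))^4 := by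
    have e1 : ((a * b) ^ ((3:ℝ)/4))^4 = (a*b)^3 := by
      rw [← Real.rpow_natCast, ← Real.rpow_mul h0.le, ← Real.rpow_natCast]
      norm_num
    rw [e1]
    calc (e-a)^4 = ((e - a)^2)^2 := by ring
      _ ≤ (a * b^2)^2 := by gcongr
      _ = a^2 * b^3 * b := by ring
      _ ≤ a^2 * b^3 * a := by gcongr
      _ = _ := by ring
  have := le_of_pow_le_pow_left₀ (by norm_num) (by positivity) h2
  linarith

lemma final_odd (k e a b : ℕ) (ha : 1 ≤ a) (hb : 1 ≤ b) (hba : b ≤ a)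
    (h : a + b < e → P k e a b) :
    (e : ℝ) ≤ ((a : ℝ) * b) ^ ((1 : ℝ) / 2 + 1 / (2 * (2 * k + 1 : ℕ))) + a := by
  have ha1 : (1:ℝ) ≤ a := by exact_mod_cast ha
  have hb1 : (1:ℝ) ≤ b := by exact_mod_cast hb
  have hba1 : (b:ℝ) ≤ a := by exact_mod_cast hba
  have hab : (1:ℝ) ≤ a * b := by nlinarith
  have hab0 : (0:ℝ) < a * b := by linarith
  set X : ℝ := ((a : ℝ) * b) ^ ((1 : ℝ) / 2 + 1 / (2 * (2 * k + 1 : ℕ))) with hX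
  have hXpos : 0 < X := by positivity
  have hX2 : X ^ 2 = (a * b) * ((a * b : ℝ) ^ ((1:ℝ) / (2 * k + 1 : ℕ))) := by
    rw [hX, ← Real.rpow_natCast, ← Real.rpow_mul hab0.le]
    nth_rewrite 2 [← Real.rpow_one ((a:ℝ) * b)]
    rw [← Real.rpow_add hab0]
    congr 1
    push_cast
    field_simp
  have hY : (1:ℝ) ≤ (a * b : ℝ) ^ ((1:ℝ) / (2 * k + 1 : ℕ)) :=
    Real.one_le_rpow hab (by positivity)
  suffices hs : ((e : ℝ) - a) ^ 2 ≤ X ^ 2 ∨ (e:ℝ) - a ≤ 0 by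
    rcases hs with hs | hs
    · have := abs_le_of_sq_le_sq hs hXpos.le
      linarith [le_abs_self ((e : ℝ) - a)]
    · linarith
  by_cases hea : (e:ℝ) - a ≤ 0
  · exact Or.inr hea
  push Not at hea
  left
  by_cases hc : a + b < e
  · have hP := h hc
    have hc1 : (a:ℝ) + b < e := by exact_mod_cast hc
    unfold P at hP
    set Q : ℝ := (1 + ((e : ℝ) - a - b) / a) * (1 + ((e : ℝ) - a - b) / b) with hQ
    have hQ0 : 0 ≤ Q := by
      have : (0:ℝ) < e - a - b := by linarith
      positivity
    have hQ1 : Q ≤ (a * b : ℝ) ^ ((1:ℝ) / (2 * k + 1 : ℕ)) := by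
      rw [one_div, Real.le_rpow_inv_iff_of_pos hQ0 hab0.le (by positivity), Real.rpow_natCast]
      exact hP
    have hQ2 : (a * b) * Q = (e - b) * (e - a) := by
      rw [hQ]; field_simp; ring
    rw [hX2]
    calc ((e:ℝ) - a)^2 = (e - a) * (e - a) := by ring
      _ ≤ (e - b) * (e - a) := by gcongr
      _ = (a*b) * Q := hQ2.symm
      _ ≤ _ := by gcongr
  · have hc1 : (e:ℝ) ≤ a + b := by exact_mod_cast not_lt.1 hc
    rw [hX2]
    have : ((e:ℝ) - a)^2 ≤ b ^ 2 := by
      apply pow_le_pow_left₀ hea.le; linarith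
    nlinarith

lemma combined (ℓ : ℕ) (hℓ : ℓ = 2 ∨ (3 ≤ ℓ ∧ Odd ℓ)) {G : SimpleGraph V} [DecidableRel G.Adj]
    {S T : Finset V} (hb : G.IsBipartiteWith (S : Set V) T) (hf : EvenCycleFree G ℓ)
    (hT : 1 ≤ T.card) (hTS : T.card ≤ S.card) :
    (G.edgeFinset.card : ℝ) ≤
      ((S.card : ℝ) * T.card) ^ ((1 : ℝ) / 2 + 1 / (2 * ℓ)) + S.card := by
  rcases hℓ with rfl | ⟨-, k, rfl⟩
  · have := final_two _ _ _ (by exact_mod_cast hT.trans hTS) (by exact_mod_cast hT)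
      (by exact_mod_cast hTS) (c4_bound hb hf)
    convert this using 3
    norm_num
  · exact final_odd k _ _ _ (hT.trans hTS) hT hTS (main_odd k _ G S T rfl hb hf)

end ZUB

/-- `z(a, b, 𝓒_{2ℓ}) ≤ (ab)^{1/2 + 1/(2ℓ)} + max(a, b)`: every `𝓒_{2ℓ}`-free
bipartite graph with parts of sizes `a` and `b` has at most that many edges. -/
theorem zarankiewicz_unbalanced_bound (ℓ : ℕ) (hℓ : ℓ = 2 ∨ (3 ≤ ℓ ∧ Odd ℓ))
    (a b : ℕ) (ha : 1 ≤ a) (hb : 1 ≤ b)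
    (G : SimpleGraph (Fin a ⊕ Fin b))
    (hbipL : ∀ x y : Fin a, ¬ G.Adj (Sum.inl x) (Sum.inl y))
    (hbipR : ∀ x y : Fin b, ¬ G.Adj (Sum.inr x) (Sum.inr y))
    (hfree : EvenCycleFree G ℓ) :
    (G.edgeSet.ncard : ℝ) ≤
      ((a : ℝ) * b) ^ ((1 : ℝ) / 2 + 1 / (2 * ℓ)) + (max a b : ℕ) := by
  classical
  let S : Finset (Fin a ⊕ Fin b) := Finset.univ.map Function.Embedding.inl
  let T : Finset (Fin a ⊕ Fin b) := Finset.univ.map Function.Embedding.inr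
  have hS : S.card = a := by simp [S]
  have hT : T.card = b := by simp [T]
  have hbip : G.IsBipartiteWith (S : Set (Fin a ⊕ Fin b)) T := by
    refine ⟨?_, ?_⟩
    · rw [Finset.disjoint_coe, Finset.disjoint_left]
      rintro (x | x) <;> simp [S, T]
    · rintro (x | x) (y | y) h
      · exact absurd h (hbipL x y)
      · simp [S, T]
      · simp [S, T]
      · exact absurd h (hbipR x y)
  have hE : G.edgeSet.ncard = G.edgeFinset.card := by
    rw [← coe_edgeFinset, Set.ncard_coe_finset]
  rw [hE]
  rcases le_total b a with h | h
  · have := ZUB.combined ℓ hℓ hbip hfree (by omega) (by omega)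
    rw [hS, hT] at this
    rwa [max_eq_left h]
  · have := ZUB.combined ℓ hℓ hbip.symm hfree (by omega) (by omega)
    rw [hS, hT, mul_comm (b : ℝ)] at this
    rwa [max_eq_right h]
end

section
/- Let G be a graph with no cycle of length 4, let A and B be subsets of the vertex set of G, let ε be a real number with 0 < ε < √3, and let S = {v ∈ A : v has at least (1+ε)·|B|^{1/2} neighbors in B}. Then e(S, B) ≤ 2|B|/ε. -/
open SimpleGraph

/-- `e(S, T)`: the number of ordered pairs `(s, t)` with `s ∈ S`, `t ∈ T`
and `st` an edge. -/
noncomputable def ePairs {V : Type*} (G : SimpleGraph V) (S T : Set V) : ℕ :=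
  Set.ncard {p : V × V | p.1 ∈ S ∧ p.2 ∈ T ∧ G.Adj p.1 p.2}

lemma c4_common {V : Type*} (G : SimpleGraph V) (hC4 : ¬ HasCycleLength G 4)
    {u v x y : V} (huv : u ≠ v) (hux : G.Adj u x) (huy : G.Adj u y)
    (hvx : G.Adj v x) (hvy : G.Adj v y) : x = y := by
  by_contra hxy
  apply hC4
  refine ⟨u, .cons hux (.cons hvx.symm (.cons hvy (.cons huy.symm .nil))), ?_, by simp⟩
  have h1 := hux.ne
  have h2 := huy.ne
  have h3 := hvx.ne
  have h4 := hvy.ne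
  rw [SimpleGraph.Walk.isCycle_def, SimpleGraph.Walk.isTrail_def]
  simp [Sym2.eq_iff]
  grind

lemma c4_count {V : Type*} [Fintype V] (G : SimpleGraph V) (hC4 : ¬ HasCycleLength G 4)
    (S B : Finset V) (a : V → V → ℝ)
    (ha1 : ∀ u w, G.Adj u w → a u w = 1) (ha0 : ∀ u w, ¬ G.Adj u w → a u w = 0) :
    ∑ w ∈ B, (∑ u ∈ S, a u w) ^ 2 ≤ (∑ u ∈ S, ∑ w ∈ B, a u w) + (S.card : ℝ) ^ 2 := by
  classical
  have hsq : ∀ u w, a u w * a u w = a u w := by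
    intro u w
    by_cases h : G.Adj u w
    · simp [ha1 u w h]
    · simp [ha0 u w h]
  have hkey : ∀ u v, ∑ w ∈ B, a u w * a v w ≤ (if u = v then ∑ w ∈ B, a u w else 0) + 1 := by
    intro u v
    by_cases huv : u = v
    · subst huv
      simp [hsq]
    · simp only [huv, if_false, zero_add]
      have : ∀ w ∈ B, a u w * a v w = if (G.Adj u w ∧ G.Adj v w) then 1 else 0 := by
        intro w _
        by_cases h : G.Adj u w
        · by_cases h' : G.Adj v w
          · simp [ha1 u w h, ha1 v w h', h, h']
          · simp [ha0 v w h', h']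
        · simp [ha0 u w h, h]
      rw [Finset.sum_congr rfl this, Finset.sum_boole]
      have : (B.filter (fun w => G.Adj u w ∧ G.Adj v w)).card ≤ 1 := by
        rw [Finset.card_le_one]
        intro x hx y hy
        simp only [Finset.mem_filter] at hx hy
        exact c4_common G hC4 huv hx.2.1 hy.2.1 hx.2.2 hy.2.2
      exact_mod_cast this
  calc ∑ w ∈ B, (∑ u ∈ S, a u w) ^ 2
      = ∑ u ∈ S, ∑ v ∈ S, ∑ w ∈ B, a u w * a v w := by
        simp_rw [sq, Finset.sum_mul_sum]
        rw [Finset.sum_comm]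
        refine Finset.sum_congr rfl fun u _ => ?_
        rw [Finset.sum_comm]
    _ ≤ ∑ u ∈ S, ∑ v ∈ S, ((if u = v then ∑ w ∈ B, a u w else 0) + 1) :=
        Finset.sum_le_sum fun u _ => Finset.sum_le_sum fun v _ => hkey u v
    _ = _ := by
        simp only [Finset.sum_add_distrib, Finset.sum_ite_eq]
        rw [Finset.sum_congr rfl (fun u hu => if_pos hu)]
        simp [sq]

lemma c4_arith (e b s ε : ℝ) (hb : 0 ≤ b) (hs : 0 ≤ s) (he : 0 ≤ e) (hε : 0 < ε)
    (h3 : ε ^ 2 < 3) (h1 : e ^ 2 ≤ b * (e + s ^ 2)) (h2 : s * ((1 + ε) * √b) ≤ e) :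
    e ≤ 2 * b / ε := by
  rw [le_div_iff₀ hε]
  have h4 : s ^ 2 * ((1 + ε) ^ 2 * b) ≤ e ^ 2 := by
    have := pow_le_pow_left₀ (by positivity) h2 2
    rwa [mul_pow, mul_pow, Real.sq_sqrt hb] at this
  rcases he.eq_or_lt with he | he
  · rw [← he]; linarith
  have h5 : e * (ε * (2 + ε)) ≤ b * (1 + ε) ^ 2 := by
    have : e * (e * (ε * (2 + ε))) ≤ e * (b * (1 + ε) ^ 2) := by
      nlinarith [mul_le_mul_of_nonneg_right h1 (sq_nonneg (1 + ε))]
    exact le_of_mul_le_mul_left this he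
  have h6 : (e * ε) * (2 + ε) ≤ (2 * b) * (2 + ε) := by nlinarith
  exact le_of_mul_le_mul_right h6 (by linarith)

/-- In a `C₄`-free graph, the set `S` of vertices of `A` with at least
`(1+ε)·|B|^{1/2}` neighbors in `B` satisfies `e(S, B) ≤ 2|B|/ε`. -/
theorem c4_free_high_degree_edges {V : Type*} [Fintype V] (G : SimpleGraph V)
    (hC4 : ¬ HasCycleLength G 4) (A B : Set V) (ε : ℝ) (hε0 : 0 < ε)
    (hε3 : ε < Real.sqrt 3) :
    (ePairs G {v ∈ A | (1 + ε) * Real.sqrt (B.ncard : ℝ) ≤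
        (((G.neighborSet v) ∩ B).ncard : ℝ)} B : ℝ)
      ≤ 2 * (B.ncard : ℝ) / ε := by
  classical
  set T : Set V := {v ∈ A | (1 + ε) * Real.sqrt (B.ncard : ℝ) ≤
        (((G.neighborSet v) ∩ B).ncard : ℝ)} with hT
  set S : Finset V := T.toFinset with hS
  set B' : Finset V := B.toFinset with hB'
  have hBc : B.ncard = B'.card := Set.ncard_eq_toFinset_card' B
  let a : V → V → ℝ := fun u w => if G.Adj u w then 1 else 0
  have hcount := c4_count G hC4 S B' a (fun u w h => by simp [a, h]) (fun u w h => by simp [a, h])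
  have hE : (ePairs G T B : ℝ) = ∑ u ∈ S, ∑ w ∈ B', a u w := by
    rw [← Finset.sum_product', Finset.sum_boole]
    have : {p : V × V | p.1 ∈ T ∧ p.2 ∈ B ∧ G.Adj p.1 p.2}
        = ↑((S ×ˢ B').filter (fun p => G.Adj p.1 p.2)) := by
      ext p
      simp [hS, hB', and_assoc]
    rw [ePairs, this, Set.ncard_coe_finset]
  have hdeg : ∀ u ∈ S, (1 + ε) * √(B.ncard : ℝ) ≤ ∑ w ∈ B', a u w := by
    intro u hu
    have hu' : u ∈ T := by simpa [hS] using hu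
    refine hu'.2.trans (le_of_eq ?_)
    rw [Finset.sum_boole]
    have : G.neighborSet u ∩ B = ↑(B'.filter (fun w => G.Adj u w)) := by
      ext w
      simp [hB', and_comm]
    rw [this, Set.ncard_coe_finset]
  have hlow := Finset.card_nsmul_le_sum S _ _ hdeg
  rw [nsmul_eq_mul, ← hE] at hlow
  rw [← hE] at hcount
  have hcs := sq_sum_le_card_mul_sum_sq (s := B') (f := fun w => ∑ u ∈ S, a u w)
  rw [Finset.sum_comm, ← hE, ← hBc] at hcs
  refine c4_arith _ _ (S.card : ℝ) ε (by positivity) (by positivity) (by positivity) hε0 ?_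
    (hcs.trans (mul_le_mul_of_nonneg_left hcount (by positivity))) hlow
  exact (Real.lt_sqrt hε0.le).1 hε3
end

section
/- (Expander mixing lemma.) Let G be a d-regular graph on n ≥ 1 vertices with real adjacency matrix A, and let λ ≥ 0 be a real number such that for every vector x ∈ ℝ^{V(G)} whose coordinates sum to zero, ‖Ax‖ ≤ λ‖x‖ (Euclidean norm). Then for all vertex subsets S, T ⊆ V(G), |e(S, T) − (d/n)·|S|·|T|| ≤ λ·√(|S|·|T|). -/
open SimpleGraph

/-- Expander mixing lemma: if `G` is `d`-regular on `n` vertices and `‖Ax‖ ≤ λ‖x‖`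
(Euclidean norms) for every vector `x` with coordinates summing to zero, then
`|e(S,T) − (d/n)|S||T|| ≤ λ√(|S||T|)` for all vertex subsets `S`, `T`. -/
theorem expander_mixing_lemma {V : Type*} [Fintype V] (G : SimpleGraph V)
    [DecidableRel G.Adj] (hn : 1 ≤ Fintype.card V) (d : ℕ)
    (hreg : G.IsRegularOfDegree d) (lam : ℝ) (hlam : 0 ≤ lam)
    (hgap : ∀ x : V → ℝ, (∑ v, x v) = 0 →
      Real.sqrt (∑ v, ((G.adjMatrix ℝ).mulVec x v) ^ 2) ≤
        lam * Real.sqrt (∑ v, (x v) ^ 2))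
    (S T : Set V) :
    |(ePairs G S T : ℝ) - (d : ℝ) / (Fintype.card V : ℝ) * S.ncard * T.ncard|
      ≤ lam * Real.sqrt ((S.ncard : ℝ) * T.ncard) := by
  classical
  have hn0 : (0 : ℝ) < (Fintype.card V : ℝ) := by exact_mod_cast hn
  have hS : (S.ncard : ℝ) = ∑ v, (if v ∈ S then (1 : ℝ) else 0) := by
    rw [Set.ncard_eq_toFinset_card', Finset.sum_boole]
    congr 2
    ext v; simp
  have hT : (T.ncard : ℝ) = ∑ v, (if v ∈ T then (1 : ℝ) else 0) := by
    rw [Set.ncard_eq_toFinset_card', Finset.sum_boole]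
    congr 2
    ext v; simp
  have hE : (ePairs G S T : ℝ) = ∑ v, (if v ∈ S then (1 : ℝ) else 0) *
      ∑ w, G.adjMatrix ℝ v w * (if w ∈ T then (1 : ℝ) else 0) := by
    unfold ePairs
    rw [Set.ncard_eq_toFinset_card']
    simp_rw [Finset.mul_sum]
    rw [← Fintype.sum_prod_type' (f := fun v w => (if v ∈ S then (1 : ℝ) else 0) *
      (G.adjMatrix ℝ v w * (if w ∈ T then (1 : ℝ) else 0)))]
    have : ∀ p : V × V, (if p.1 ∈ S then (1 : ℝ) else 0) *
      (G.adjMatrix ℝ p.1 p.2 * (if p.2 ∈ T then (1 : ℝ) else 0)) =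
      if (p.1 ∈ S ∧ p.2 ∈ T ∧ G.Adj p.1 p.2) then (1 : ℝ) else 0 := by
      intro p
      rw [SimpleGraph.adjMatrix_apply]
      by_cases h1 : p.1 ∈ S <;> by_cases h2 : p.2 ∈ T <;> by_cases h3 : G.Adj p.1 p.2 <;>
        simp [h1, h2, h3]
    simp_rw [this]
    rw [Finset.sum_boole]
    congr 2
    ext p; simp
  have hdeg : ∀ v, ∑ w, G.adjMatrix ℝ v w = d := by
    intro v
    have h := hreg v
    simp_rw [SimpleGraph.adjMatrix_apply]
    rw [Finset.sum_boole, ← h, ← SimpleGraph.card_neighborFinset_eq_degree]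
    congr 2
    ext w; simp
  set s : ℝ := (S.ncard : ℝ) with hs
  set t : ℝ := (T.ncard : ℝ) with ht
  set n : ℝ := (Fintype.card V : ℝ) with hnn
  have hs0 : 0 ≤ s := by positivity
  have ht0 : 0 ≤ t := by positivity
  let x : V → ℝ := fun v => (if v ∈ T then (1 : ℝ) else 0) - t / n
  have hx0 : ∑ v, x v = 0 := by
    simp only [x]
    rw [Finset.sum_sub_distrib, ← hT, Finset.sum_const, Finset.card_univ, nsmul_eq_mul, ← hnn]
    field_simp
    ring
  have hx2 : ∑ v, (x v) ^ 2 ≤ t := by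
    have e : ∀ v, (x v) ^ 2 = (1 - 2 * (t / n)) * (if v ∈ T then (1 : ℝ) else 0) + (t / n) ^ 2 := by
      intro v
      simp only [x]
      split_ifs <;> ring
    simp_rw [e]
    rw [Finset.sum_add_distrib, ← Finset.mul_sum, ← hT, Finset.sum_const, Finset.card_univ,
      nsmul_eq_mul, ← hnn]
    have : (1 - 2 * (t / n)) * t + n * (t / n) ^ 2 = t - t ^ 2 / n := by
      field_simp
      ring
    rw [this]
    have : 0 ≤ t ^ 2 / n := by positivity
    linarith
  have hAx : ∀ v, (G.adjMatrix ℝ).mulVec x v =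
      ∑ w, G.adjMatrix ℝ v w * (if w ∈ T then (1 : ℝ) else 0) - d * (t / n) := by
    intro v
    simp only [Matrix.mulVec, dotProduct, x, mul_sub]
    rw [Finset.sum_sub_distrib, ← Finset.sum_mul, hdeg]
  have hmain : (ePairs G S T : ℝ) - (d : ℝ) / n * s * t =
      ∑ v, (if v ∈ S then (1 : ℝ) else 0) * (G.adjMatrix ℝ).mulVec x v := by
    simp_rw [hAx, mul_sub]
    rw [Finset.sum_sub_distrib, ← hE, ← Finset.sum_mul, ← hS]
    ring
  have hS2 : ∑ v, (if v ∈ S then (1 : ℝ) else 0) ^ 2 = s := by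
    rw [hS]
    refine Finset.sum_congr rfl fun v _ => ?_
    split_ifs <;> norm_num
  rw [hmain]
  have hcs := Finset.sum_mul_sq_le_sq_mul_sq Finset.univ
    (fun v => if v ∈ S then (1 : ℝ) else 0) (fun v => (G.adjMatrix ℝ).mulVec x v)
  rw [hS2] at hcs
  calc _ ≤ Real.sqrt (s * ∑ v, ((G.adjMatrix ℝ).mulVec x v) ^ 2) := Real.abs_le_sqrt hcs
    _ = Real.sqrt s * Real.sqrt (∑ v, ((G.adjMatrix ℝ).mulVec x v) ^ 2) := Real.sqrt_mul hs0 _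
    _ ≤ Real.sqrt s * (lam * Real.sqrt (∑ v, (x v) ^ 2)) := by
      gcongr
      exact hgap x hx0
    _ ≤ Real.sqrt s * (lam * Real.sqrt t) := by gcongr
    _ = lam * Real.sqrt (s * t) := by rw [Real.sqrt_mul hs0]; ring
end

section
/- Let G be a d-regular bipartite graph, d ≥ 1, on n vertices with parts X and Y (so |X| = |Y| = n/2), with real adjacency matrix A. Let λ ≥ 0 be a real number such that for every vector x ∈ ℝ^{V(G)} orthogonal both to the all-ones vector and to the vector that equals +1 on X and −1 on Y, one has ‖Ax‖ ≤ λ‖x‖ (Euclidean norm). Then for all S ⊆ X and T ⊆ Y, |e(S, T) − (2d/n)·|S|·|T|| ≤ λ·(|S| + |T|)/2. -/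
open SimpleGraph

/-- Bipartite expander mixing lemma: if `G` is a `d`-regular bipartite graph on
`n` vertices with parts `X`, `Y` and `‖Ax‖ ≤ λ‖x‖` (Euclidean norms) for every
vector `x` orthogonal to the all-ones vector and to the `±1` vector of the
bipartition, then `|e(S,T) − (2d/n)|S||T|| ≤ λ(|S|+|T|)/2` for `S ⊆ X`, `T ⊆ Y`. -/
theorem bipartite_expander_mixing_lemma {V : Type*} [Fintype V]
    (G : SimpleGraph V) [DecidableRel G.Adj]
    (X Y : Set V) [DecidablePred (· ∈ X)] (hXY : Disjoint X Y)
    (hcover : X ∪ Y = Set.univ)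
    (hbip : ∀ u v, G.Adj u v → (u ∈ X ∧ v ∈ Y) ∨ (u ∈ Y ∧ v ∈ X))
    (d : ℕ) (hd : 1 ≤ d) (hreg : G.IsRegularOfDegree d)
    (lam : ℝ) (hlam : 0 ≤ lam)
    (hgap : ∀ x : V → ℝ, (∑ v, x v) = 0 →
      (∑ v, (if v ∈ X then x v else - x v)) = 0 →
      Real.sqrt (∑ v, ((G.adjMatrix ℝ).mulVec x v) ^ 2) ≤
        lam * Real.sqrt (∑ v, (x v) ^ 2))
    (S T : Set V) (hS : S ⊆ X) (hT : T ⊆ Y) :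
    |(ePairs G S T : ℝ) -
        2 * (d : ℝ) / (Fintype.card V : ℝ) * S.ncard * T.ncard|
      ≤ lam * ((S.ncard : ℝ) + T.ncard) / 2 := by
  classical
  set A := G.adjMatrix ℝ with hA
  have hrow : ∀ u, ∑ v, A u v = d := by
    intro u
    have h := SimpleGraph.adjMatrix_mulVec_const_apply_of_regular (G := G) (a := (1 : ℝ)) hreg (v := u)
    simpa [Matrix.mulVec, dotProduct, hA] using h
  have hsymm : ∀ u v, A u v = A v u := fun u v => by
    simp [hA, SimpleGraph.adjMatrix_apply, G.adj_comm]
  have hmem : ∀ v, v ∈ Y ↔ v ∉ X := by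
    intro v
    have h1 : v ∈ X ∪ Y := by rw [hcover]; trivial
    constructor
    · intro hy hx
      exact Set.disjoint_left.mp hXY hx hy
    · intro hx
      exact h1.resolve_left hx
  let ix : V → ℝ := fun v => if v ∈ X then 1 else 0
  let iy : V → ℝ := fun v => if v ∈ Y then 1 else 0
  let is : V → ℝ := fun v => if v ∈ S then 1 else 0
  let it : V → ℝ := fun v => if v ∈ T then 1 else 0
  have hixy : ∀ v, ix v + iy v = 1 := by
    intro v
    by_cases hv : v ∈ X <;> simp [ix, iy, hmem, hv]
  have hAXY : ∀ u v, A u v * ix u = A u v * iy v := by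
    intro u v
    by_cases h : G.Adj u v
    · rcases hbip u v h with ⟨h1, h2⟩ | ⟨h1, h2⟩
      · simp [ix, iy, h1, h2]
      · have := (hmem u).1 h1
        simp [ix, iy, this, hmem, h2]
    · simp [hA, SimpleGraph.adjMatrix_apply, h]
  set m : ℝ := ∑ v, iy v with hm
  have hd0 : (d : ℝ) ≠ 0 := by
    have : d ≠ 0 := by omega
    exact_mod_cast this
  have hmx : ∑ v, ix v = m := by
    have h1 : ∑ u, ∑ v, A u v * ix u = d * ∑ u, ix u := by
      simp_rw [← Finset.sum_mul, hrow, Finset.mul_sum]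
    have h2 : ∑ u, ∑ v, A u v * ix u = d * m := by
      simp_rw [hAXY]
      rw [Finset.sum_comm, hm, Finset.mul_sum]
      refine Finset.sum_congr rfl fun v _ => ?_
      rw [← Finset.sum_mul]
      congr 1
      rw [← hrow v]
      exact Finset.sum_congr rfl fun u _ => hsymm _ _
    exact mul_left_cancel₀ hd0 (h1.symm.trans h2)
  have hn : (Fintype.card V : ℝ) = 2 * m := by
    have : ∑ v, (ix v + iy v) = (Fintype.card V : ℝ) := by simp [hixy]
    rw [← this, Finset.sum_add_distrib, hmx]; ring
  have hcard : ∀ U : Set V, (U.ncard : ℝ) = ∑ v, if v ∈ U then (1 : ℝ) else 0 := by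
    intro U
    rw [Set.ncard_eq_toFinset_card', Finset.sum_boole]
    congr 2
    ext v; simp
  have hs : (S.ncard : ℝ) = ∑ v, is v := hcard S
  have ht : (T.ncard : ℝ) = ∑ v, it v := hcard T
  have he : (ePairs G S T : ℝ) = ∑ u, ∑ v, is u * (A u v * it v) := by
    have h0 : (ePairs G S T : ℝ) =
        ∑ p : V × V, if p ∈ {p : V × V | p.1 ∈ S ∧ p.2 ∈ T ∧ G.Adj p.1 p.2} then (1 : ℝ) else 0 := by
      unfold ePairs
      rw [Set.ncard_eq_toFinset_card', Finset.sum_boole]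
      congr 2
      ext v; simp
    rw [h0, Fintype.sum_prod_type]
    refine Finset.sum_congr rfl fun u _ => Finset.sum_congr rfl fun v _ => ?_
    by_cases h1 : u ∈ S <;> by_cases h2 : v ∈ T <;> by_cases h3 : G.Adj u v <;>
      simp [is, it, hA, SimpleGraph.adjMatrix_apply, h1, h2, h3]
  rcases isEmpty_or_nonempty V with hV | hV
  · rw [he, hs, ht]; simp
  have hm0 : m > 0 := by
    have : (0 : ℝ) < Fintype.card V := by exact_mod_cast Fintype.card_pos
    linarith
  set t : ℝ := (T.ncard : ℝ) with htdef
  set s : ℝ := (S.ncard : ℝ) with hsdef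
  have ht0 : 0 ≤ t := by positivity
  have hs0 : 0 ≤ s := by positivity
  let x : V → ℝ := fun v => it v - t / m * iy v
  have hx1 : ∑ v, x v = 0 := by
    simp only [x]
    rw [Finset.sum_sub_distrib, ← Finset.mul_sum, ← ht, ← hm]
    field_simp; ring
  have hxX : ∀ v, v ∈ X → x v = 0 := by
    intro v hv
    have h1 : v ∉ Y := fun h => (hmem v).1 h hv
    have h2 : v ∉ T := fun h => h1 (hT h)
    simp [x, it, iy, h1, h2]
  have hx2 : (∑ v, (if v ∈ X then x v else - x v)) = 0 := by
    have : ∀ v, (if v ∈ X then x v else - x v) = - x v := by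
      intro v
      by_cases hv : v ∈ X
      · simp [hv, hxX v hv]
      · simp [hv]
    simp_rw [this]
    rw [Finset.sum_neg_distrib, hx1, neg_zero]
  have hxn : ∑ v, (x v) ^ 2 ≤ t := by
    have h1 : ∀ v, (x v) ^ 2 = it v - 2 * (t / m) * it v + (t / m) ^ 2 * iy v := by
      intro v
      by_cases hv : v ∈ T
      · have := hT hv
        simp only [x, it, iy, hv, this, if_true]; ring
      · by_cases hy : v ∈ Y <;> simp [x, it, iy, hv, hy]
    simp_rw [h1]
    rw [Finset.sum_add_distrib, Finset.sum_sub_distrib, ← Finset.mul_sum, ← Finset.mul_sum, ← ht,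
      ← hm]
    have h2 : (t / m) ^ 2 * m = t ^ 2 / m := by field_simp
    have h3 : 2 * (t / m) * t = 2 * (t ^ 2 / m) := by field_simp
    have h4 : 0 ≤ t ^ 2 / m := by positivity
    rw [h2, h3]; linarith
  have hQ : (ePairs G S T : ℝ) - 2 * (d : ℝ) / (Fintype.card V : ℝ) * s * t
      = ∑ u, is u * (A.mulVec x u) := by
    have h1 : ∀ u, is u * (A.mulVec x u) = (∑ v, is u * (A u v * it v)) - (d * (t / m)) * is u := by
      intro u
      have h2 : A.mulVec x u = (∑ v, A u v * it v) - t / m * ∑ v, A u v * iy v := by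
        simp only [Matrix.mulVec, dotProduct, x]
        rw [Finset.mul_sum, ← Finset.sum_sub_distrib]
        exact Finset.sum_congr rfl fun v _ => by ring
      have h3 : ∑ v, A u v * iy v = d * ix u := by
        simp_rw [← hAXY]
        rw [← Finset.sum_mul, hrow]
      have h4 : is u * ix u = is u := by
        by_cases hu : u ∈ S
        · simp [is, ix, hu, hS hu]
        · simp [is, hu]
      rw [h2, h3, ← Finset.mul_sum]
      linear_combination (- (t / m) * d) * h4
    simp_rw [h1]
    rw [Finset.sum_sub_distrib, ← he, ← Finset.mul_sum, ← hs, hn]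
    field_simp
  have hCS : (∑ u, is u * (A.mulVec x u)) ^ 2 ≤ s * ∑ u, (A.mulVec x u) ^ 2 := by
    have h := Finset.sum_mul_sq_le_sq_mul_sq Finset.univ is (A.mulVec x)
    have h2 : ∑ u, is u ^ 2 = s := by
      rw [hs]
      exact Finset.sum_congr rfl fun u _ => by by_cases hu : u ∈ S <;> simp [is, hu]
    rwa [h2] at h
  have hg := hgap x hx1 hx2
  have hg2 : ∑ u, (A.mulVec x u) ^ 2 ≤ lam ^ 2 * t := by
    rw [Real.sqrt_le_left (by positivity), mul_pow, Real.sq_sqrt (by positivity)] at hg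
    exact hg.trans (by gcongr)
  rw [hQ]
  apply abs_le_of_sq_le_sq _ (by positivity)
  calc _ ≤ s * ∑ u, (A.mulVec x u) ^ 2 := hCS
    _ ≤ s * (lam ^ 2 * t) := by gcongr
    _ ≤ _ := by nlinarith [mul_nonneg (sq_nonneg lam) (sq_nonneg (s - t))]
end
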